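/- (Duality, type I; Proposition 6.9 of the paper) For every k ∈ ℕ and all compositions u, w ∈ ℕ^n: (i) Σ_{v : |v| = k} ⟦u, v⟧(a, b) ⟦v, w⟧(c, d) = Σ_{v : |v| = |u| + |w| − k} ⟦u, v⟧(c, d) ⟦v, w⟧(a, b), and (ii) Σ_{v : |v| = k} [u; v][v; w] = Σ_{v : |v| = |u| + |w| − k} [u; v][v; w], where the sums are over compositions v ∈ ℕ^n of the indicated size (a sum over an empty index condition, e.g. when |u| + |w| − k < 0, is zero). -/

import Mathlib

open scoped BigOperators
open MvPolynomial

noncomputable section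
namespace LRW

variable {n : ℕ}

/-- `|u|`, the weight of a composition `u ∈ ℕⁿ`. -/
def wt (u : Fin n → ℕ) : ℕ := ∑ i, u i

/-- `l'_u(i) = #{k > i : u_k > u_i} + #{k < i : u_k ≥ u_i}`. -/
def lp (u : Fin n → ℕ) (i : Fin n) : ℕ :=
  (Finset.univ.filter fun k => i < k ∧ u i < u k).card +
  (Finset.univ.filter fun k => k < i ∧ u i ≤ u k).card

/-- The spectral vector `⟨u⟩ : ⟨u⟩_i = q^{u_i} t^{n−1−l'_u(i)}`. -/
def spec (q t : ℂ) (u : Fin n → ℕ) : Fin n → ℂ :=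
  fun i => q ^ u i * t ^ (n - 1 - lp u i)

/-- Leg length `l(s)` of the cell `s = (i, j+1)` of `u` (so `j` ranges over
`0, …, u_i − 1`): `l(s) = #{k > i : j+1 ≤ u_k ≤ u_i} + #{k < i : j+1 ≤ u_k + 1 ≤ u_i}`. -/
def leg (u : Fin n → ℕ) (i : Fin n) (j : ℕ) : ℕ :=
  (Finset.univ.filter fun k => i < k ∧ j < u k ∧ u k ≤ u i).card +
  (Finset.univ.filter fun k => k < i ∧ j ≤ u k ∧ u k < u i).card

/-- `n(u) = Σ_{s ∈ u} l(s)`. -/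
def nstat (u : Fin n → ℕ) : ℕ := ∑ i, ∑ j ∈ Finset.range (u i), leg u i j

/-- `n'(u) = Σ_i C(u_i, 2)`. -/
def nstat' (u : Fin n → ℕ) : ℕ := ∑ i, Nat.choose (u i) 2

/-- `n(u⁺) = Σ_{i<j} min(u_i, u_j)`, the statistic `n` of the decreasing
rearrangement of `u`. -/
def nplus (u : Fin n → ℕ) : ℕ := ∑ i, ∑ j, if i < j then min (u i) (u j) else 0

/-- `τ_u = (−1)^{|u|} q^{n'(u)} t^{−n(u⁺)}`. -/
def tau (q t : ℂ) (u : Fin n → ℕ) : ℂ := (-1) ^ wt u * q ^ nstat' u / t ^ nplus u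

/-- The generalized q-shifted factorial `(z)_u = ∏_{s ∈ u} (1 − z q^{a'(s)} t^{−l'(s)})`. -/
def qfac (q t z : ℂ) (u : Fin n → ℕ) : ℂ :=
  ∏ i, ∏ j ∈ Finset.range (u i), (1 - z * q ^ j / t ^ lp u i)

/-- `c'_u = ∏_{s ∈ u} (1 − q^{a(s)+1} t^{l(s)})`. -/
def cp (q t : ℂ) (u : Fin n → ℕ) : ℂ :=
  ∏ i, ∏ j ∈ Finset.range (u i), (1 - q ^ (u i - j) * t ^ leg u i j)

/-- `M` is a family of interpolation Macdonald polynomials: `M u` has total degree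
at most `|u|`, the coefficient of `x^u` in `M u` is `q^{−n'(u)}`, and `M u`
vanishes at `⟨v⟩` for every `v` with `|v| ≤ |u|`, `v ≠ u`. -/
def IsInterpFamily (q t : ℂ) (M : (Fin n → ℕ) → MvPolynomial (Fin n) ℂ) : Prop :=
  ∀ u, (M u).totalDegree ≤ wt u ∧
    coeff (Finsupp.equivFunOnFinite.symm u) (M u) = (q ^ nstat' u)⁻¹ ∧
    ∀ v, wt v ≤ wt u → v ≠ u → eval (spec q t v) (M u) = 0

/-- `𝖬_u = q^{n'(u)} t^{n(u)} M_u / c'_u`. -/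
def MM (q t : ℂ) (M : (Fin n → ℕ) → MvPolynomial (Fin n) ℂ) (u : Fin n → ℕ) :
    MvPolynomial (Fin n) ℂ :=
  C (q ^ nstat' u * t ^ nstat u / cp q t u) * M u

/-- `𝖤_u = t^{n(u)} E_u / c'_u`, where `E_u` is the homogeneous component of
degree `|u|` of `M_u`. -/
def EE (q t : ℂ) (M : (Fin n → ℕ) → MvPolynomial (Fin n) ℂ) (u : Fin n → ℕ) :
    MvPolynomial (Fin n) ℂ :=
  C (t ^ nstat u / cp q t u) * homogeneousComponent (wt u) (M u)

/-- The generalized q-binomial coefficient `[u; v] = 𝖬_v(⟨u⟩)/𝖬_v(⟨v⟩)`. -/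
def qbin (q t : ℂ) (M : (Fin n → ℕ) → MvPolynomial (Fin n) ℂ) (u v : Fin n → ℕ) : ℂ :=
  eval (spec q t u) (MM q t M v) / eval (spec q t v) (MM q t M v)

/-- `⟨0⟩/a = (t^{n−1}/a, …, t/a, 1/a)`. -/
def spec0div (q t a : ℂ) : Fin n → ℂ := fun i => spec q t (fun _ => 0) i / a

/-- `cc` is the family of connection coefficients `c_{uv}(a,b)`:
`cc u v = 0` unless `|v| ≤ |u|`, and `𝖬_u(a·x) = Σ_v cc u v · 𝖬_v(b·x)`. -/
def IsConnection (q t : ℂ) (M : (Fin n → ℕ) → MvPolynomial (Fin n) ℂ) (a b : ℂ)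
    (cc : (Fin n → ℕ) → (Fin n → ℕ) → ℂ) : Prop :=
  (∀ u v, wt u < wt v → cc u v = 0) ∧
  ∀ u, aeval (fun i => C a * X i) (MM q t M u) =
    ∑ᶠ v, cc u v • aeval (fun i => C b * X i) (MM q t M v)

/-- `⟦u, v⟧(a, b) = (𝖤_v(⟨0⟩/a)/𝖤_u(⟨0⟩/b)) · c_{uv}(a, b)`. -/
def skew (q t : ℂ) (M : (Fin n → ℕ) → MvPolynomial (Fin n) ℂ) (a b : ℂ)
    (cc : (Fin n → ℕ) → (Fin n → ℕ) → ℂ) (u v : Fin n → ℕ) : ℂ :=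
  eval (spec0div q t a) (EE q t M v) / eval (spec0div q t b) (EE q t M u) * cc u v

/-- `(z; q)_∞ = ∏_{m ≥ 0} (1 − z q^m)`. -/
noncomputable def qpochInf (z q : ℂ) : ℂ := ∏' m : ℕ, (1 - z * q ^ m)

/-- Polynomials in `m + 1` variables. -/
abbrev Poly (m : ℕ) := MvPolynomial (Fin (m + 1)) ℂ

/-- The space of polynomials of total degree less than `d`. -/
def degLT (m d : ℕ) : Submodule ℂ (Poly m) := restrictSupport ℂ {s | s.degree < d}

/-- The dilation `f(x) ↦ f(z x)`. -/
def dil {m : ℕ} (z : ℂ) : Poly m →ₐ[ℂ] Poly m := aeval fun i => C z * X i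

section Degree

variable {m : ℕ}

lemma mem_degLT {d : ℕ} {f : Poly m} :
    f ∈ degLT m d ↔ ∀ s, d ≤ s.degree → coeff s f = 0 := by
  rw [degLT, mem_restrictSupport_iff]
  constructor
  · intro h s hs
    by_contra hc
    exact absurd (h (mem_support_iff.2 hc)) (by simpa using hs)
  · intro h s hs
    by_contra hc
    exact (mem_support_iff.1 hs) (h s (by simpa using hc))

lemma degLT_mono {d e : ℕ} (h : d ≤ e) : degLT m d ≤ degLT m e := fun _ hf =>
  mem_degLT.2 fun s hs => mem_degLT.1 hf s (h.trans hs)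

lemma eq_zero_of_mem_degLT_zero {f : Poly m} (hf : f ∈ degLT m 0) : f = 0 := by
  ext s
  simpa using mem_degLT.1 hf s (Nat.zero_le _)

lemma mem_degLT_of_isHomogeneous {d e : ℕ} {f : Poly m} (hf : f.IsHomogeneous d) (h : d < e) :
    f ∈ degLT m e :=
  mem_degLT.2 fun s hs => hf.coeff_eq_zero (by omega)

lemma mem_degLT_of_totalDegree_le {d : ℕ} {f : Poly m} (hf : f.totalDegree ≤ d) :
    f ∈ degLT m (d + 1) :=
  mem_degLT.2 fun s hs => coeff_eq_zero_of_totalDegree_lt (by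
    rw [← Finsupp.degree_apply]; omega)

lemma sub_homogeneousComponent_mem_degLT {d : ℕ} {f : Poly m} (hf : f ∈ degLT m (d + 1)) :
    f - homogeneousComponent d f ∈ degLT m d := by
  refine mem_degLT.2 fun s hs => ?_
  rw [coeff_sub, coeff_homogeneousComponent]
  split_ifs with h
  · simp
  · rw [mem_degLT.1 hf s (by omega), sub_zero]

lemma X_mul_mem_degLT {d : ℕ} {f : Poly m} (i : Fin (m + 1)) (hf : f ∈ degLT m d) :
    X i * f ∈ degLT m (d + 1) := by
  refine mem_degLT.2 fun s hs => ?_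
  rw [coeff_X_mul']
  split_ifs with h
  · refine mem_degLT.1 hf _ ?_
    have h1 : Finsupp.single i 1 ≤ s := by
      rw [Finsupp.single_le_iff]
      exact Nat.one_le_iff_ne_zero.2 (Finsupp.mem_support_iff.1 h)
    have h2 := congrArg Finsupp.degree (tsub_add_cancel_of_le h1)
    rw [map_add, Finsupp.degree_single] at h2
    omega
  · rfl

lemma homogeneousComponent_of_mem_degLT {d : ℕ} {f : Poly m} (hf : f ∈ degLT m d) :
    homogeneousComponent d f = 0 := by
  ext s
  rw [coeff_homogeneousComponent]
  split_ifs with h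
  · simpa using mem_degLT.1 hf s h.ge
  · simp

/-- A linear map sends `degLT m d` to a submodule as soon as it sends there all homogeneous
polynomials of degree less than `d`. -/
lemma map_mem_of_mem_degLT {d : ℕ} (A : Poly m →ₗ[ℂ] Poly m) (S : Submodule ℂ (Poly m))
    (h : ∀ k f, k < d → f.IsHomogeneous k → A f ∈ S) {f : Poly m} (hf : f ∈ degLT m d) :
    A f ∈ S := by
  rw [← sum_homogeneousComponent f, map_sum]
  refine Submodule.sum_mem _ fun k _ => ?_
  by_cases hk : k < d
  · exact h k _ hk (homogeneousComponent_isHomogeneous k f)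
  · rw [homogeneousComponent_of_mem_degLT (degLT_mono (not_lt.1 hk) hf), map_zero]
    exact S.zero_mem

lemma coeff_dil (z : ℂ) (f : Poly m) (s : Fin (m + 1) →₀ ℕ) :
    coeff s (dil z f) = z ^ s.degree * coeff s f := by
  induction f using MvPolynomial.induction_on' with
  | add p q hp hq => rw [map_add, coeff_add, hp, hq, coeff_add, mul_add]
  | monomial u a =>
    have h : dil z (monomial u a) = C (z ^ u.degree) * monomial u a := by
      rw [dil, aeval_monomial, monomial_eq]
      simp only [mul_pow, Finsupp.prod_mul]
      have : (u.prod fun _ e => (C z : Poly m) ^ e) = C (z ^ u.degree) := by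
        rw [Finsupp.prod, Finset.prod_pow_eq_pow_sum, map_pow]; rfl
      rw [this]
      change C a * _ = _
      ring
    rw [h, coeff_C_mul, coeff_monomial]
    split_ifs with hu
    · rw [hu]
    · simp

lemma dil_of_isHomogeneous {d : ℕ} {f : Poly m} (hf : f.IsHomogeneous d) (z : ℂ) :
    dil z f = z ^ d • f := by
  ext s
  rw [coeff_dil, coeff_smul, smul_eq_mul]
  by_cases h : s.degree = d
  · rw [h]
  · rw [hf.coeff_eq_zero h]; simp

lemma isHomogeneous_of_dil_two {d : ℕ} {f : Poly m} (hf : dil 2 f = (2 : ℂ) ^ d • f) :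
    f.IsHomogeneous d := by
  rw [← mem_homogeneousSubmodule, homogeneousSubmodule_eq_finsupp_supported]
  refine fun s hs => ?_
  have h1 := congrArg (coeff s) hf
  rw [coeff_dil, coeff_smul, smul_eq_mul] at h1
  have h2 := mul_right_cancel₀ (mem_support_iff.1 hs) h1
  have h3 : ((2 ^ s.degree : ℕ) : ℂ) = ((2 ^ d : ℕ) : ℂ) := by push_cast; exact h2
  exact Nat.pow_right_injective le_rfl (Nat.cast_injective h3)

lemma dil_dil (y z : ℂ) (f : Poly m) : dil y (dil z f) = dil (y * z) f := by
  ext s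
  simp only [coeff_dil]
  ring

lemma dil_one (f : Poly m) : dil 1 f = f := by
  ext s
  simp [coeff_dil]

lemma dil_X (z : ℂ) (i : Fin (m + 1)) : dil z (X i : Poly m) = C z * X i := by
  simp [dil]

lemma dil_C (z a : ℂ) : dil z (C a : Poly m) = C a := by
  simp [dil]

end Degree

section Hecke

variable {m : ℕ}

/-- The adjacent transposition of the positions `i` and `i + 1`. -/
abbrev adj (i : Fin m) : Equiv.Perm (Fin (m + 1)) := Equiv.swap i.castSucc i.succ

lemma X_sub_X_dvd_rename_swap_sub (i : Fin m) (f : Poly m) :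
    (X i.castSucc - X i.succ : Poly m) ∣ rename (adj i) f - f := by
  rw [← Ideal.mem_span_singleton, ← Ideal.Quotient.eq]
  set I := Ideal.span {(X i.castSucc - X i.succ : Poly m)}
  have hX : Ideal.Quotient.mk I (X i.castSucc) = Ideal.Quotient.mk I (X i.succ) :=
    Ideal.Quotient.eq.2 (Ideal.mem_span_singleton_self _)
  have : (Ideal.Quotient.mkₐ ℂ I).comp (rename (adj i)) = Ideal.Quotient.mkₐ ℂ I := by
    refine MvPolynomial.algHom_ext fun k => ?_
    simp only [AlgHom.comp_apply, rename_X, Ideal.Quotient.mkₐ_eq_mk]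
    rcases eq_or_ne k i.castSucc with rfl | h1
    · rw [Equiv.swap_apply_left, hX]
    rcases eq_or_ne k i.succ with rfl | h2
    · rw [Equiv.swap_apply_right, hX]
    · rw [Equiv.swap_apply_of_ne_of_ne h1 h2]
  exact congrArg (fun φ => φ f) this

lemma X_sub_X_ne_zero (i : Fin m) : (X i.castSucc - X i.succ : Poly m) ≠ 0 :=
  sub_ne_zero.2 fun h => (Fin.castSucc_lt_succ (i := i)).ne (X_injective h)

/-- The divided difference `(s_i f - f) / (x_i - x_{i+1})`. -/
def divDiff (i : Fin m) : Poly m →ₗ[ℂ] Poly m where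
  toFun f := (X_sub_X_dvd_rename_swap_sub i f).choose
  map_add' f g := by
    refine mul_left_cancel₀ (X_sub_X_ne_zero i) ?_
    rw [mul_add, ← (X_sub_X_dvd_rename_swap_sub i f).choose_spec,
      ← (X_sub_X_dvd_rename_swap_sub i g).choose_spec,
      ← (X_sub_X_dvd_rename_swap_sub i (f + g)).choose_spec, map_add]
    ring
  map_smul' r f := by
    refine mul_left_cancel₀ (X_sub_X_ne_zero i) ?_
    rw [RingHom.id_apply, mul_smul_comm, ← (X_sub_X_dvd_rename_swap_sub i f).choose_spec,
      ← (X_sub_X_dvd_rename_swap_sub i (r • f)).choose_spec, map_smul, smul_sub]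

lemma X_sub_X_mul_divDiff (i : Fin m) (f : Poly m) :
    (X i.castSucc - X i.succ) * divDiff i f = rename (adj i) f - f :=
  (X_sub_X_dvd_rename_swap_sub i f).choose_spec.symm

/-- The Demazure–Lusztig operator `T_i = 1 + (x_i / t - x_{i+1}) / (x_i - x_{i+1}) (s_i - 1)`. -/
def hecke (t : ℂ) (i : Fin m) : Poly m →ₗ[ℂ] Poly m :=
  LinearMap.id + LinearMap.mulLeft ℂ (C t⁻¹ * X i.castSucc - X i.succ) ∘ₗ divDiff i

lemma hecke_apply (t : ℂ) (i : Fin m) (f : Poly m) :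
    hecke t i f = f + (C t⁻¹ * X i.castSucc - X i.succ) * divDiff i f := rfl

lemma X_sub_X_mul_hecke (t : ℂ) (i : Fin m) (f : Poly m) :
    (X i.castSucc - X i.succ) * hecke t i f = (X i.castSucc - X i.succ) * f +
      (C t⁻¹ * X i.castSucc - X i.succ) * (rename (adj i) f - f) := by
  rw [hecke_apply, ← X_sub_X_mul_divDiff]
  ring

lemma rename_adj_rename_adj (i : Fin m) (f : Poly m) :
    rename (adj i) (rename (adj i) f) = f := by
  rw [rename_rename]
  have : (adj i : Fin (m + 1) → Fin (m + 1)) ∘ adj i = id := by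
    ext k; simp
  rw [this, rename_id_apply]

lemma hecke_quadratic (t : ℂ) (i : Fin m) (f : Poly m) :
    hecke t i (hecke t i f) = (1 - C t⁻¹) * hecke t i f + C t⁻¹ * f := by
  have h1 := X_sub_X_mul_hecke t i f
  have h2 := X_sub_X_mul_hecke t i (hecke t i f)
  have h3 := congrArg (rename (adj i)) h1
  simp only [map_mul, map_sub, map_add, rename_X, rename_C, Equiv.swap_apply_left,
    Equiv.swap_apply_right, rename_adj_rename_adj] at h3
  refine mul_left_cancel₀ (mul_ne_zero (X_sub_X_ne_zero i) (X_sub_X_ne_zero i)) ?_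
  linear_combination (X i.castSucc - X i.succ) * h2 -
    (C t⁻¹ * X i.castSucc - X i.succ) * h3 +
    ((X i.castSucc - X i.succ) - (C t⁻¹ * X i.castSucc - X i.succ) -
      (X i.castSucc - X i.succ) * (1 - C t⁻¹)) * h1

lemma isUnit_hecke {t : ℂ} (ht : t ≠ 0) (i : Fin m) :
    IsUnit (hecke t i : Module.End ℂ (Poly m)) := by
  set T : Module.End ℂ (Poly m) := hecke t i
  have h : T * T = (1 - t⁻¹) • T + t⁻¹ • (1 : Module.End ℂ (Poly m)) := by
    refine LinearMap.ext fun f => ?_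
    have := hecke_quadratic t i f
    change T (T f) = (1 - t⁻¹) • T f + t⁻¹ • f
    rw [this, smul_eq_C_mul, smul_eq_C_mul, C_sub, C_1]
  have h2 : T * (t • T + (1 - t) • 1) = 1 := by
    rw [mul_add, mul_smul_comm, mul_smul_comm, h, mul_one, smul_add, smul_smul, smul_smul,
      mul_inv_cancel₀ ht, one_smul, mul_sub, mul_inv_cancel₀ ht, mul_one, add_right_comm,
      ← add_smul]
    simp
  have h3 : (t • T + (1 - t) • 1) * T = 1 := by
    refine Eq.trans ?_ h2
    simp only [mul_add, add_mul, mul_smul_comm, smul_mul_assoc, one_mul, mul_one]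
  exact ⟨⟨T, _, h2, h3⟩, rfl⟩

lemma dil_rename (z : ℂ) (σ : Fin (m + 1) → Fin (m + 1)) (f : Poly m) :
    dil z (rename σ f) = rename σ (dil z f) := by
  have : (dil z).comp (rename σ) = (rename σ).comp (dil (m := m) z) := by
    refine MvPolynomial.algHom_ext fun k => ?_
    simp [dil_X]
  exact congrArg (fun φ => φ f) this

lemma dil_hecke {z : ℂ} (hz : z ≠ 0) (t : ℂ) (i : Fin m) (f : Poly m) :
    dil z (hecke t i f) = hecke t i (dil z f) := by
  have h1 := congrArg (dil z) (X_sub_X_mul_hecke t i f)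
  simp only [map_mul, map_sub, map_add, dil_X, dil_C, dil_rename] at h1
  refine mul_left_cancel₀ (X_sub_X_ne_zero i) ?_
  refine mul_left_cancel₀ (C_ne_zero.2 hz) ?_
  rw [X_sub_X_mul_hecke]
  linear_combination h1

lemma X_dvd_hecke_sub_rename (t : ℂ) (i : Fin m) (f : Poly m) :
    X i.castSucc ∣ hecke t i f - rename (adj i) f := by
  refine ⟨(C t⁻¹ - 1) * divDiff i f, ?_⟩
  rw [hecke_apply]
  linear_combination X_sub_X_mul_divDiff i f

lemma hecke_C (t : ℂ) (i : Fin m) (a : ℂ) : hecke t i (C a) = C a := by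
  refine mul_left_cancel₀ (X_sub_X_ne_zero i) ?_
  rw [X_sub_X_mul_hecke, rename_C]
  ring

/-- The product `T_j T_{j+1} ⋯ T_m`. -/
def heckeProd (t : ℂ) (j : Fin (m + 1)) : Module.End ℂ (Poly m) :=
  Fin.reverseInduction (motive := fun _ => Module.End ℂ (Poly m)) 1
    (fun i W => (hecke t i : Module.End ℂ (Poly m)) * W) j

lemma heckeProd_last (t : ℂ) : heckeProd t (Fin.last m) = 1 := by simp [heckeProd]

lemma heckeProd_castSucc (t : ℂ) (i : Fin m) :
    heckeProd t i.castSucc = (hecke t i : Module.End ℂ (Poly m)) * heckeProd t i.succ := by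
  simp [heckeProd]

/-- The cycle `s_j s_{j+1} ⋯ s_m`. -/
def cycProd (j : Fin (m + 1)) : Equiv.Perm (Fin (m + 1)) :=
  Fin.reverseInduction (motive := fun _ => Equiv.Perm (Fin (m + 1))) 1
    (fun i W => adj i * W) j

lemma cycProd_last : cycProd (Fin.last m) = 1 := by simp [cycProd]

lemma cycProd_castSucc (i : Fin m) : cycProd i.castSucc = adj i * cycProd i.succ := by
  simp [cycProd]

lemma isUnit_heckeProd {t : ℂ} (ht : t ≠ 0) (j : Fin (m + 1)) : IsUnit (heckeProd t j) := by
  induction j using Fin.reverseInduction with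
  | last => rw [heckeProd_last]; exact isUnit_one
  | cast i ih => rw [heckeProd_castSucc]; exact (isUnit_hecke ht i).mul ih

lemma dil_heckeProd {z : ℂ} (hz : z ≠ 0) (t : ℂ) (j : Fin (m + 1)) (f : Poly m) :
    dil z (heckeProd t j f) = heckeProd t j (dil z f) := by
  induction j using Fin.reverseInduction with
  | last => simp [heckeProd_last]
  | cast i ih =>
    rw [heckeProd_castSucc, Module.End.mul_apply, Module.End.mul_apply, dil_hecke hz, ih]

lemma heckeProd_C (t : ℂ) (j : Fin (m + 1)) (a : ℂ) : heckeProd t j (C a) = C a := by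
  induction j using Fin.reverseInduction with
  | last => simp [heckeProd_last]
  | cast i ih => rw [heckeProd_castSucc, Module.End.mul_apply, ih, hecke_C]

lemma X_dvd_heckeProd_sub_rename (t : ℂ) (j : Fin (m + 1)) (f : Poly m) :
    X j ∣ heckeProd t j f - rename (cycProd j) f := by
  induction j using Fin.reverseInduction with
  | last => simp [heckeProd_last, cycProd_last]
  | cast i ih =>
    obtain ⟨h, hh⟩ := ih
    rw [heckeProd_castSucc, Module.End.mul_apply, cycProd_castSucc, Equiv.Perm.coe_mul,
      ← rename_rename, sub_eq_iff_eq_add.1 hh]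
    obtain ⟨g, hg⟩ := X_dvd_hecke_sub_rename t i (X i.succ * h + rename (cycProd i.succ) f)
    refine ⟨g + rename (adj i) h, ?_⟩
    rw [sub_eq_iff_eq_add.1 hg, map_add, map_mul, rename_X, Equiv.swap_apply_right]
    ring

lemma cycProd_apply_last (j : Fin (m + 1)) : cycProd j (Fin.last m) = j := by
  induction j using Fin.reverseInduction with
  | last => simp [cycProd_last]
  | cast i ih => rw [cycProd_castSucc, Equiv.Perm.mul_apply, ih, Equiv.swap_apply_right]

lemma cycProd_apply_castSucc (j : Fin (m + 1)) (k : Fin m) :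
    cycProd j k.castSucc = if j ≤ k.castSucc then k.succ else k.castSucc := by
  induction j using Fin.reverseInduction with
  | last =>
    rw [cycProd_last, if_neg (not_le.2 (Fin.castSucc_lt_last k))]; rfl
  | cast i ih =>
    rw [cycProd_castSucc, Equiv.Perm.mul_apply, ih]
    rcases lt_trichotomy i k with h | h | h
    · rw [if_pos, if_pos, Equiv.swap_apply_of_ne_of_ne]
      all_goals simp only [ne_eq, Fin.ext_iff, Fin.le_def, Fin.val_succ, Fin.val_castSucc]
      all_goals rw [Fin.lt_def] at h
      all_goals omega
    · subst h
      rw [if_neg, if_pos le_rfl, Equiv.swap_apply_left]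
      simp [Fin.le_def]
    · rw [if_neg, if_neg, Equiv.swap_apply_of_ne_of_ne]
      all_goals simp only [ne_eq, Fin.ext_iff, Fin.le_def, Fin.val_succ, Fin.val_castSucc]
      all_goals rw [Fin.lt_def] at h
      all_goals omega

/-- The affine rotation `f(x) ↦ f(x_n / q, x_1, …, x_{n-1})`. -/
def rot (q : ℂ) : Poly m →ₐ[ℂ] Poly m :=
  aeval (Fin.cons (C q⁻¹ * X (Fin.last m)) fun i => X i.castSucc)

lemma dil_rot (z q : ℂ) (f : Poly m) : dil z (rot q f) = rot q (dil z f) := by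
  have : (dil z).comp (rot q) = (rot q).comp (dil (m := m) z) := by
    refine MvPolynomial.algHom_ext fun k => ?_
    refine Fin.cases ?_ (fun i => ?_) k
    · simp [dil_X, rot]
      ring
    · simp [dil_X, rot]
  exact congrArg (fun φ => φ f) this

lemma X_last_dvd_rot_rename_sub (q : ℂ) (f : Poly m) :
    X (Fin.last m) ∣ rot q (rename (cycProd 0) f) - f := by
  rw [← Ideal.mem_span_singleton, ← Ideal.Quotient.eq]
  set I := Ideal.span {(X (Fin.last m) : Poly m)}
  have hX : Ideal.Quotient.mk I (X (Fin.last m)) = 0 :=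
    Ideal.Quotient.eq_zero_iff_mem.2 (Ideal.mem_span_singleton_self _)
  have : (Ideal.Quotient.mkₐ ℂ I).comp ((rot q).comp (rename (cycProd 0))) =
      Ideal.Quotient.mkₐ ℂ I := by
    refine MvPolynomial.algHom_ext fun k => ?_
    simp only [AlgHom.comp_apply, rename_X, Ideal.Quotient.mkₐ_eq_mk]
    refine Fin.lastCases ?_ (fun i => ?_) k
    · rw [cycProd_apply_last]
      simp [rot, hX]
    · rw [cycProd_apply_castSucc, if_pos (Fin.zero_le _)]
      simp [rot]
  exact congrArg (fun φ => φ f) this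

/-- The inverse Cherednik operator `ω T_1 ⋯ T_m`, with `ω` the affine rotation. -/
def cher (q t : ℂ) : Poly m →ₗ[ℂ] Poly m := (rot q).toLinearMap ∘ₗ heckeProd t 0

lemma cher_apply (q t : ℂ) (f : Poly m) : cher q t f = rot q (heckeProd t 0 f) := rfl

lemma X_last_dvd_sub_cher (q t : ℂ) (f : Poly m) : X (Fin.last m) ∣ f - cher q t f := by
  obtain ⟨g, hg⟩ := X_dvd_heckeProd_sub_rename t 0 f
  rw [cher_apply, sub_eq_iff_eq_add.1 hg, map_add, map_mul, dvd_sub_comm, add_sub_assoc]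
  refine dvd_add (Dvd.dvd.mul_right ?_ _) (X_last_dvd_rot_rename_sub q f)
  simp [rot]

/-- The operator `(1 - ω T_1 ⋯ T_m) / x_n`. -/
def cherQuot (q t : ℂ) : Poly m →ₗ[ℂ] Poly m where
  toFun f := (X_last_dvd_sub_cher q t f).choose
  map_add' f g := by
    refine mul_left_cancel₀ (X_ne_zero (R := ℂ) (Fin.last m)) ?_
    rw [mul_add, ← (X_last_dvd_sub_cher q t f).choose_spec,
      ← (X_last_dvd_sub_cher q t g).choose_spec,
      ← (X_last_dvd_sub_cher q t (f + g)).choose_spec, map_add]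
    ring
  map_smul' r f := by
    refine mul_left_cancel₀ (X_ne_zero (R := ℂ) (Fin.last m)) ?_
    rw [RingHom.id_apply, mul_smul_comm, ← (X_last_dvd_sub_cher q t f).choose_spec,
      ← (X_last_dvd_sub_cher q t (r • f)).choose_spec, map_smul, smul_sub]

lemma X_last_mul_cherQuot (q t : ℂ) (f : Poly m) :
    X (Fin.last m) * cherQuot q t f = f - cher q t f :=
  (X_last_dvd_sub_cher q t f).choose_spec.symm

lemma dil_cher {z : ℂ} (hz : z ≠ 0) (q t : ℂ) (f : Poly m) :
    dil z (cher q t f) = cher q t (dil z f) := by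
  rw [cher_apply, cher_apply, dil_rot, dil_heckeProd hz]

lemma cherQuot_dil {z : ℂ} (hz : z ≠ 0) (q t : ℂ) (f : Poly m) :
    cherQuot q t (dil z f) = C z * dil z (cherQuot q t f) := by
  refine mul_left_cancel₀ (X_ne_zero (R := ℂ) (Fin.last m)) ?_
  have := congrArg (dil z) (X_last_mul_cherQuot q t f)
  rw [map_mul, map_sub, dil_X, dil_cher hz] at this
  rw [X_last_mul_cherQuot, ← this]
  ring

lemma cher_C (q t a : ℂ) : cher (m := m) q t (C a) = C a := by
  rw [cher_apply, heckeProd_C]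
  simp [rot]

lemma isHomogeneous_of_dil_comm {A : Poly m →ₗ[ℂ] Poly m} (hA : ∀ f, dil 2 (A f) = A (dil 2 f))
    {d : ℕ} {f : Poly m} (hf : f.IsHomogeneous d) : (A f).IsHomogeneous d :=
  isHomogeneous_of_dil_two (by rw [hA, dil_of_isHomogeneous hf, map_smul])

lemma mem_degLT_of_dil_comm {A : Poly m →ₗ[ℂ] Poly m} (hA : ∀ f, dil 2 (A f) = A (dil 2 f))
    {d : ℕ} {f : Poly m} (hf : f ∈ degLT m d) : A f ∈ degLT m d :=
  map_mem_of_mem_degLT A _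
    (fun _ _ hk h => mem_degLT_of_isHomogeneous (isHomogeneous_of_dil_comm hA h) hk) hf

lemma isHomogeneous_hecke (t : ℂ) (i : Fin m) {d : ℕ} {f : Poly m} (hf : f.IsHomogeneous d) :
    (hecke t i f).IsHomogeneous d :=
  isHomogeneous_of_dil_comm (dil_hecke two_ne_zero t i) hf

lemma hecke_mem_degLT (t : ℂ) (i : Fin m) {d : ℕ} {f : Poly m} (hf : f ∈ degLT m d) :
    hecke t i f ∈ degLT m d :=
  mem_degLT_of_dil_comm (dil_hecke two_ne_zero t i) hf

lemma isHomogeneous_rot (q : ℂ) {d : ℕ} {f : Poly m} (hf : f.IsHomogeneous d) :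
    (rot q f).IsHomogeneous d :=
  isHomogeneous_of_dil_comm (A := (rot q).toLinearMap) (dil_rot 2 q) hf

lemma rot_mem_degLT (q : ℂ) {d : ℕ} {f : Poly m} (hf : f ∈ degLT m d) :
    rot q f ∈ degLT m d :=
  mem_degLT_of_dil_comm (A := (rot q).toLinearMap) (dil_rot 2 q) hf

lemma isHomogeneous_cher (q t : ℂ) {d : ℕ} {f : Poly m} (hf : f.IsHomogeneous d) :
    (cher q t f).IsHomogeneous d :=
  isHomogeneous_of_dil_comm (dil_cher two_ne_zero q t) hf

lemma cher_mem_degLT (q t : ℂ) {d : ℕ} {f : Poly m} (hf : f ∈ degLT m d) :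
    cher q t f ∈ degLT m d :=
  mem_degLT_of_dil_comm (dil_cher two_ne_zero q t) hf

lemma cherQuot_mem_degLT (q t : ℂ) {d : ℕ} {f : Poly m} (hf : f ∈ degLT m (d + 1)) :
    cherQuot q t f ∈ degLT m d := by
  refine map_mem_of_mem_degLT (cherQuot q t) _ (fun k g hk hg => ?_) hf
  rcases k with _ | k
  · obtain ⟨a, rfl⟩ : ∃ a, g = C a := ⟨_, (totalDegree_eq_zero_iff_eq_C.1
      ((totalDegree_zero_iff_isHomogeneous _).2 hg))⟩
    have : cherQuot q t (C a : Poly m) = 0 := by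
      refine mul_left_cancel₀ (X_ne_zero (R := ℂ) (Fin.last m)) ?_
      rw [X_last_mul_cherQuot, cher_C, sub_self, mul_zero]
    rw [this]
    exact Submodule.zero_mem _
  · refine mem_degLT_of_isHomogeneous (d := k) (isHomogeneous_of_dil_two ?_) (by omega)
    have h := cherQuot_dil two_ne_zero q t g
    rw [dil_of_isHomogeneous hg, map_smul] at h
    refine mul_left_cancel₀ (C_ne_zero.2 (two_ne_zero (α := ℂ))) ?_
    rw [← h, smul_eq_C_mul, smul_eq_C_mul, pow_succ, C_mul]
    ring

end Hecke

/-- The parameters satisfy no multiplicative relation. -/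
structure Generic (q t : ℂ) : Prop where
  q_ne_zero : q ≠ 0
  t_ne_zero : t ≠ 0
  zpow_ne_one : ∀ i j : ℤ, ¬(i = 0 ∧ j = 0) → q ^ i * t ^ j ≠ 1

lemma Generic.pow_inj {q t : ℂ} (hg : Generic q t) {a b c d : ℕ}
    (h : q ^ a * t ^ b = q ^ c * t ^ d) : a = c ∧ b = d := by
  by_contra hne
  refine hg.zpow_ne_one (a - c) (b - d) (fun h => hne (by omega)) ?_
  rw [zpow_sub₀ hg.q_ne_zero, zpow_sub₀ hg.t_ne_zero]
  have h1 := pow_ne_zero c hg.q_ne_zero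
  have h2 := pow_ne_zero d hg.t_ne_zero
  simp only [zpow_natCast]
  field_simp
  linear_combination h

section Compositions

variable {m : ℕ}

lemma wt_zero : wt (0 : Fin (m + 1) → ℕ) = 0 := by simp [wt]

lemma eq_zero_of_wt_eq_zero {u : Fin (m + 1) → ℕ} (h : wt u = 0) : u = 0 :=
  funext fun i => Finset.sum_eq_zero_iff.1 h i (Finset.mem_univ i)

lemma wt_comp_adj (u : Fin (m + 1) → ℕ) (i : Fin m) : wt (u ∘ adj i) = wt u :=
  Equiv.sum_comp (adj i) u

lemma comp_adj_comp_adj (u : Fin (m + 1) → ℕ) (i : Fin m) : (u ∘ adj i) ∘ adj i = u := by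
  ext k
  simp

lemma comp_adj_of_eq {u : Fin (m + 1) → ℕ} {i : Fin m} (h : u i.castSucc = u i.succ) :
    u ∘ adj i = u := by
  ext k
  rw [Function.comp_apply, Equiv.swap_apply_def]
  split_ifs with h1 h2
  · rw [h1, h]
  · rw [h2, h]
  · rfl

/-- The map `(u_1, …, u_n) ↦ (u_2, …, u_n, u_1 + 1)` on compositions. -/
def raise (u : Fin (m + 1) → ℕ) : Fin (m + 1) → ℕ :=
  Fin.snoc (α := fun _ => ℕ) (fun i => u i.succ) (u 0 + 1)

lemma raise_last (u : Fin (m + 1) → ℕ) : raise u (Fin.last m) = u 0 + 1 := by simp [raise]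

lemma raise_castSucc (u : Fin (m + 1) → ℕ) (i : Fin m) : raise u i.castSucc = u i.succ := by
  simp [raise]

lemma wt_raise (u : Fin (m + 1) → ℕ) : wt (raise u) = wt u + 1 := by
  rw [wt, Fin.sum_univ_castSucc, wt, Fin.sum_univ_succ u]
  simp only [raise_last, raise_castSucc]
  omega

lemma exists_raise_eq {u : Fin (m + 1) → ℕ} (h : u (Fin.last m) ≠ 0) : ∃ w, raise w = u := by
  refine ⟨Fin.cons (u (Fin.last m) - 1) fun i => u i.castSucc, funext fun k => ?_⟩
  refine Fin.lastCases ?_ (fun i => ?_) k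
  · rw [raise_last, Fin.cons_zero]; omega
  · rw [raise_castSucc, Fin.cons_succ]

/-- Every composition is obtained from `0` by the operations `raise` and `· ∘ adj i`. -/
lemma composition_induction {p : (Fin (m + 1) → ℕ) → Prop} (zero : p 0)
    (raise : ∀ u, p u → p (raise u)) (adj : ∀ u i, p u → p (u ∘ adj i)) (u) : p u := by
  induction hd : wt u using Nat.strong_induction_on generalizing u with
  | _ d ih =>
    by_cases h0 : ∃ j, u j ≠ 0
    · obtain ⟨j, hj⟩ := h0
      induction j using Fin.reverseInduction generalizing u with
      | last =>
        obtain ⟨w, rfl⟩ := exists_raise_eq hj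
        exact raise w (ih (wt w) (by rw [← hd, wt_raise]; omega) w rfl)
      | cast i hi =>
        rw [← comp_adj_comp_adj u i]
        refine adj _ i (hi _ ?_ ?_)
        · rw [wt_comp_adj, hd]
        · rwa [Function.comp_apply, Equiv.swap_apply_right]
    · have : u = 0 := funext fun j => by_contra fun h => h0 ⟨j, h⟩
      rwa [this]

lemma lp_eq_card (u : Fin (m + 1) → ℕ) (i : Fin (m + 1)) :
    lp u i = (Finset.univ.filter fun k => u i < u k ∨ (u i = u k ∧ k < i)).card := by
  rw [lp, ← Finset.card_union_of_disjoint]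
  · congr 1
    ext k
    simp only [Finset.mem_union, Finset.mem_filter, Finset.mem_univ, true_and]
    rcases lt_trichotomy i k with h | rfl | h
    · simp [h, h.not_gt]
    · simp
    · simp [h, h.not_gt, le_iff_lt_or_eq]
  · rw [Finset.disjoint_filter]
    intro k _ h1 h2
    exact h1.1.asymm h2.1

lemma lp_le (u : Fin (m + 1) → ℕ) (i : Fin (m + 1)) : lp u i ≤ m := by
  rw [lp_eq_card]
  have : (Finset.univ.filter fun k => u i < u k ∨ (u i = u k ∧ k < i)) ⊆ Finset.univ.erase i := by
    intro k hk
    simp only [Finset.mem_filter, Finset.mem_univ, true_and] at hk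
    refine Finset.mem_erase.2 ⟨?_, Finset.mem_univ k⟩
    rintro rfl
    simp at hk
  simpa using Finset.card_le_card this

lemma lp_of_perm {u v : Fin (m + 1) → ℕ} (σ : Equiv.Perm (Fin (m + 1))) (j : Fin (m + 1))
    (h : ∀ k, (v j < v k ∨ (v j = v k ∧ k < j)) ↔
      (u (σ j) < u (σ k) ∨ (u (σ j) = u (σ k) ∧ σ k < σ j))) : lp v j = lp u (σ j) := by
  rw [lp_eq_card, lp_eq_card]
  refine Finset.card_equiv σ fun k => ?_
  simp only [Finset.mem_filter, Finset.mem_univ, true_and]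
  exact h k

lemma lp_comp_adj {u : Fin (m + 1) → ℕ} {i : Fin m} (h : u i.castSucc ≠ u i.succ)
    (j : Fin (m + 1)) : lp (u ∘ adj i) j = lp u (adj i j) := by
  refine lp_of_perm _ _ fun k => ?_
  simp only [Function.comp_apply]
  refine or_congr_right (and_congr_right fun hjk => ?_)
  rw [Equiv.swap_apply_def, Equiv.swap_apply_def] at hjk ⊢
  split_ifs at hjk ⊢ <;>
    simp only [Fin.lt_def, Fin.ext_iff, Fin.val_succ, Fin.val_castSucc] at * <;> omega

lemma lp_raise_last (u : Fin (m + 1) → ℕ) : lp (raise u) (Fin.last m) = lp u 0 := by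
  have := lp_of_perm (u := u) (v := raise u) (finRotate (m + 1)) (Fin.last m) fun k => ?_
  · rwa [finRotate_last] at this
  · refine Fin.lastCases ?_ (fun l => ?_) k
    · simp
    · rw [finRotate_last, finRotate_apply, Fin.coeSucc_eq_succ, raise_last, raise_castSucc]
      simp only [Fin.castSucc_lt_last, and_true, Fin.not_lt_zero, and_false, or_false]
      omega

lemma lp_raise_castSucc (u : Fin (m + 1) → ℕ) (i : Fin m) :
    lp (raise u) i.castSucc = lp u i.succ := by
  have := lp_of_perm (u := u) (v := raise u) (finRotate (m + 1)) i.castSucc fun k => ?_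
  · rwa [finRotate_apply, Fin.coeSucc_eq_succ] at this
  · refine Fin.lastCases ?_ (fun l => ?_) k
    · rw [finRotate_last, finRotate_apply, Fin.coeSucc_eq_succ, raise_last, raise_castSucc]
      simp only [(Fin.castSucc_lt_last i).not_gt, and_false, or_false, Fin.succ_pos, and_true]
      omega
    · simp only [finRotate_apply, Fin.coeSucc_eq_succ, raise_castSucc,
        Fin.castSucc_lt_castSucc_iff, Fin.succ_lt_succ_iff]

lemma lp_succ_of_eq {u : Fin (m + 1) → ℕ} {i : Fin m} (h : u i.castSucc = u i.succ) :
    lp u i.succ = lp u i.castSucc + 1 := by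
  rw [lp_eq_card, lp_eq_card, ← Finset.card_insert_of_notMem (a := i.castSucc) (by simp)]
  congr 1
  ext k
  simp only [Finset.mem_filter, Finset.mem_univ, true_and, Finset.mem_insert, h]
  have : k < i.succ ↔ k = i.castSucc ∨ k < i.castSucc := by
    simp only [Fin.lt_def, Fin.ext_iff, Fin.val_succ, Fin.val_castSucc]; omega
  rw [this]
  constructor
  · tauto
  · rintro (rfl | h1)
    · simp [h]
    · tauto

end Compositions

section Spectral

variable {m : ℕ} {q t : ℂ}

lemma spec_apply (u : Fin (m + 1) → ℕ) (i : Fin (m + 1)) :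
    spec q t u i = q ^ u i * t ^ (m - lp u i) := rfl

lemma spec_comp_adj {u : Fin (m + 1) → ℕ} {i : Fin m} (h : u i.castSucc ≠ u i.succ) :
    spec q t (u ∘ adj i) = spec q t u ∘ adj i := by
  ext j
  rw [Function.comp_apply, spec_apply, spec_apply, lp_comp_adj h, Function.comp_apply]

lemma spec_raise_last (u : Fin (m + 1) → ℕ) :
    spec q t (raise u) (Fin.last m) = q * spec q t u 0 := by
  rw [spec_apply, spec_apply, lp_raise_last, raise_last, pow_succ]
  ring

lemma spec_raise_castSucc (u : Fin (m + 1) → ℕ) (i : Fin m) :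
    spec q t (raise u) i.castSucc = spec q t u i.succ := by
  rw [spec_apply, spec_apply, lp_raise_castSucc, raise_castSucc]

lemma spec_eq_mul_spec {u : Fin (m + 1) → ℕ} {i : Fin m} (h : u i.castSucc = u i.succ) :
    spec q t u i.castSucc = t * spec q t u i.succ := by
  have h1 := lp_le u i.succ
  have h2 := lp_succ_of_eq h
  rw [spec_apply, spec_apply, h, show m - lp u i.castSucc = (m - lp u i.succ) + 1 by omega,
    pow_succ]
  ring

lemma spec_ne_zero (hg : Generic q t) (u : Fin (m + 1) → ℕ) (i : Fin (m + 1)) :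
    spec q t u i ≠ 0 :=
  mul_ne_zero (pow_ne_zero _ hg.q_ne_zero) (pow_ne_zero _ hg.t_ne_zero)

lemma spec_castSucc_sub_succ_ne_zero (hg : Generic q t) (u : Fin (m + 1) → ℕ) (i : Fin m) :
    spec q t u i.castSucc - spec q t u i.succ ≠ 0 := fun h => by
  obtain ⟨h1, h2⟩ := hg.pow_inj (sub_eq_zero.1 h)
  have h3 := lp_succ_of_eq h1
  have h4 : lp u i.succ ≤ m := lp_le u i.succ
  change m - _ = m - _ at h2
  omega

/-- The coefficient `(⟨u⟩_i / t - ⟨u⟩_{i+1}) / (⟨u⟩_i - ⟨u⟩_{i+1})`. -/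
def heckeCoeff (q t : ℂ) (u : Fin (m + 1) → ℕ) (i : Fin m) : ℂ :=
  (t⁻¹ * spec q t u i.castSucc - spec q t u i.succ) /
    (spec q t u i.castSucc - spec q t u i.succ)

lemma heckeCoeff_of_eq (hg : Generic q t) {u : Fin (m + 1) → ℕ} {i : Fin m}
    (h : u i.castSucc = u i.succ) : heckeCoeff q t u i = 0 := by
  rw [heckeCoeff, spec_eq_mul_spec h, inv_mul_cancel_left₀ hg.t_ne_zero, sub_self, zero_div]

lemma heckeCoeff_ne_zero (hg : Generic q t) {u : Fin (m + 1) → ℕ} {i : Fin m}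
    (h : u i.castSucc ≠ u i.succ) : heckeCoeff q t u i ≠ 0 := by
  refine div_ne_zero (fun h1 => h ?_) (spec_castSucc_sub_succ_ne_zero hg u i)
  have h2 : spec q t u i.castSucc = t * spec q t u i.succ := by
    rw [← sub_eq_zero.1 h1, mul_inv_cancel_left₀ hg.t_ne_zero]
  rw [spec_apply, spec_apply, mul_left_comm, ← pow_succ'] at h2
  exact (hg.pow_inj h2).1

lemma eval_spec_hecke (hg : Generic q t) (u : Fin (m + 1) → ℕ) (i : Fin m) (f : Poly m) :
    eval (spec q t u) (hecke t i f) = (1 - heckeCoeff q t u i) * eval (spec q t u) f +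
      heckeCoeff q t u i * eval (spec q t (u ∘ adj i)) f := by
  have h := congrArg (eval (spec q t u)) (X_sub_X_mul_hecke t i f)
  have hne := spec_castSucc_sub_succ_ne_zero hg u i
  simp only [map_mul, map_sub, map_add, eval_X, eval_C, eval_rename] at h
  have h2 : heckeCoeff q t u i * (spec q t u i.castSucc - spec q t u i.succ) =
      t⁻¹ * spec q t u i.castSucc - spec q t u i.succ := div_mul_cancel₀ _ hne
  refine mul_left_cancel₀ hne ?_
  rw [h, ← h2]
  by_cases hu : u i.castSucc = u i.succ
  · rw [heckeCoeff_of_eq hg hu]; ring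
  · rw [spec_comp_adj hu]; ring

lemma eval_spec_raise_rot (hg : Generic q t) (u : Fin (m + 1) → ℕ) (f : Poly m) :
    eval (spec q t (raise u)) (rot q f) = eval (spec q t u) f := by
  have : (aeval (spec q t (raise u))).comp (rot q) = (aeval (spec q t u) : Poly m →ₐ[ℂ] ℂ) := by
    refine MvPolynomial.algHom_ext fun k => ?_
    refine Fin.cases ?_ (fun i => ?_) k
    · simp [rot, spec_raise_last, hg.q_ne_zero]
    · simp [rot, spec_raise_castSucc]
  exact congrArg (fun φ => φ f) this

lemma lp_last_of_eq_zero {u : Fin (m + 1) → ℕ} (h : u (Fin.last m) = 0) :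
    lp u (Fin.last m) = m := by
  rw [lp_eq_card]
  have : (Finset.univ.filter fun k => u (Fin.last m) < u k ∨
      (u (Fin.last m) = u k ∧ k < Fin.last m)) = Finset.univ.erase (Fin.last m) := by
    ext k
    simp only [Finset.mem_filter, Finset.mem_univ, true_and, Finset.mem_erase, h, and_true]
    rw [← Fin.lt_last_iff_ne_last]
    refine ⟨?_, fun hk => ?_⟩
    · rintro (h1 | h1)
      · refine lt_of_le_of_ne (Fin.le_last k) ?_
        rintro rfl
        omega
      · exact h1.2
    · rcases Nat.eq_zero_or_pos (u k) with h1 | h1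
      · exact Or.inr ⟨h1.symm, hk⟩
      · exact Or.inl h1
  rw [this]
  simp

lemma spec_last_of_eq_zero {u : Fin (m + 1) → ℕ} (h : u (Fin.last m) = 0) :
    spec q t u (Fin.last m) = 1 := by
  rw [spec_apply, h, lp_last_of_eq_zero h, Nat.sub_self, pow_zero, pow_zero, mul_one]

lemma spec_last_sub_one_ne_zero (hg : Generic q t) {u : Fin (m + 1) → ℕ}
    (h : u (Fin.last m) ≠ 0) : spec q t u (Fin.last m) - 1 ≠ 0 := fun h1 => h <| by
  refine (hg.pow_inj (c := 0) (d := 0) (b := m - lp u (Fin.last m)) ?_).1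
  rw [← spec_apply, sub_eq_zero.1 h1, pow_zero, pow_zero, mul_one]

/-- The raising operator `f ↦ (x_n - 1) f(x_n / q, x_1, …, x_{n-1})`. -/
def raiseOp (q : ℂ) : Poly m →ₗ[ℂ] Poly m :=
  LinearMap.mulLeft ℂ (X (Fin.last m) - 1) ∘ₗ (rot q).toLinearMap

lemma raiseOp_apply (f : Poly m) : raiseOp q f = (X (Fin.last m) - 1) * rot q f := rfl

lemma eval_spec_raiseOp_of_eq_zero {u : Fin (m + 1) → ℕ} (h : u (Fin.last m) = 0) (f : Poly m) :
    eval (spec q t u) (raiseOp q f) = 0 := by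
  rw [raiseOp_apply, map_mul, map_sub, eval_X, map_one, spec_last_of_eq_zero h, sub_self, zero_mul]

lemma eval_spec_raise_raiseOp (hg : Generic q t) (u : Fin (m + 1) → ℕ) (f : Poly m) :
    eval (spec q t (raise u)) (raiseOp q f) =
      (spec q t (raise u) (Fin.last m) - 1) * eval (spec q t u) f := by
  rw [raiseOp_apply, map_mul, map_sub, eval_X, map_one, eval_spec_raise_rot hg]

lemma raiseOp_mem_degLT {d : ℕ} {f : Poly m} (hf : f ∈ degLT m d) :
    raiseOp q f ∈ degLT m (d + 1) := by
  rw [raiseOp_apply, sub_mul, one_mul]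
  exact Submodule.sub_mem _ (X_mul_mem_degLT _ (rot_mem_degLT q hf))
    (degLT_mono (Nat.le_succ d) (rot_mem_degLT q hf))

end Spectral

section Interpolation

variable {m : ℕ} {q t : ℂ}

lemma finite_setOf_wt_lt (d : ℕ) : {v : Fin (m + 1) → ℕ | wt v < d}.Finite :=
  (Set.finite_Iic fun _ => d).subset fun v (hv : wt v < d) i =>
    (Finset.single_le_sum (f := v) (fun _ _ => Nat.zero_le _) (Finset.mem_univ i)).trans hv.le

instance (d : ℕ) : Fintype {v : Fin (m + 1) → ℕ // wt v < d} := (finite_setOf_wt_lt d).fintype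

lemma degree_eq_wt (s : Fin (m + 1) →₀ ℕ) : s.degree = wt s := Finsupp.degree_eq_sum s

/-- A monomial basis of `degLT m d`. -/
def degLTBasis (m d : ℕ) : Module.Basis {v : Fin (m + 1) → ℕ // wt v < d} ℂ (degLT m d) :=
  (basisRestrictSupport ℂ {s : Fin (m + 1) →₀ ℕ | s.degree < d}).reindex
    (Finsupp.equivFunOnFinite.subtypeEquiv fun s => by
      rw [Set.mem_ofPred_eq, degree_eq_wt]; rfl)

/-- A polynomial `f` of degree at most `|u|` which, among the spectral vectors of size at most
`|u|`, does not vanish exactly at `⟨u⟩`. -/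
structure IsSeparating (q t : ℂ) (u : Fin (m + 1) → ℕ) (f : Poly m) : Prop where
  mem_degLT : f ∈ degLT m (wt u + 1)
  eval_ne_zero : eval (spec q t u) f ≠ 0
  eval_eq_zero : ∀ v, wt v ≤ wt u → v ≠ u → eval (spec q t v) f = 0

lemma exists_isSeparating (hg : Generic q t) (u : Fin (m + 1) → ℕ) :
    ∃ f, IsSeparating q t u f := by
  induction u using composition_induction with
  | zero =>
    refine ⟨1, ⟨mem_degLT_of_isHomogeneous (isHomogeneous_one _ _) (Nat.succ_pos _), by simp,
      fun v hv hne => absurd (eq_zero_of_wt_eq_zero ?_) hne⟩⟩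
    rw [wt_zero] at hv
    omega
  | raise u ih =>
    obtain ⟨f, hf⟩ := ih
    refine ⟨raiseOp q f, ⟨?_, ?_, fun v hv hne => ?_⟩⟩
    · rw [wt_raise]
      exact raiseOp_mem_degLT hf.mem_degLT
    · rw [eval_spec_raise_raiseOp hg]
      refine mul_ne_zero (spec_last_sub_one_ne_zero hg ?_) hf.eval_ne_zero
      rw [raise_last]; omega
    · by_cases h0 : v (Fin.last m) = 0
      · exact eval_spec_raiseOp_of_eq_zero h0 f
      · obtain ⟨w, rfl⟩ := exists_raise_eq h0
        rw [wt_raise, wt_raise] at hv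
        rw [eval_spec_raise_raiseOp hg, hf.eval_eq_zero w (by omega) (fun h => hne (by rw [h])),
          mul_zero]
  | adj u i ih =>
    obtain ⟨f, hf⟩ := ih
    by_cases hu : u i.castSucc = u i.succ
    · rw [comp_adj_of_eq hu]
      exact ⟨f, hf⟩
    refine ⟨hecke t i f - (1 - heckeCoeff q t u i) • f, ⟨?_, ?_, fun v hv hne => ?_⟩⟩
    · rw [wt_comp_adj]
      exact Submodule.sub_mem _ (hecke_mem_degLT t i hf.mem_degLT)
        (Submodule.smul_mem _ _ hf.mem_degLT)
    · rw [map_sub, eval_spec_hecke hg, smul_eval, comp_adj_comp_adj,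
        hf.eval_eq_zero _ (wt_comp_adj u i).le fun h => hu ?_]
      · have : heckeCoeff q t (u ∘ adj i) i ≠ 0 := heckeCoeff_ne_zero hg (by simpa using Ne.symm hu)
        simpa using And.intro this hf.eval_ne_zero
      · simpa using (congrFun h i.castSucc).symm
    · rw [wt_comp_adj] at hv
      rw [map_sub, eval_spec_hecke hg, smul_eval,
        hf.eval_eq_zero (v ∘ adj i) (by rwa [wt_comp_adj])
          fun h => hne (by rw [← h, comp_adj_comp_adj])]
      by_cases hvu : v = u
      · rw [hvu]; ring
      · rw [hf.eval_eq_zero v hv hvu]; ring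

lemma IsSeparating.coeff_eq_zero {N : (Fin (m + 1) → ℕ) → Poly m}
    (hN : ∀ u, IsSeparating q t u (N u)) {s : Finset (Fin (m + 1) → ℕ)}
    {c : (Fin (m + 1) → ℕ) → ℂ} (h : ∀ v ∈ s, eval (spec q t v) (∑ u ∈ s, c u • N u) = 0) :
    ∀ v ∈ s, c v = 0 := by
  intro v
  induction hd : wt v using Nat.strong_induction_on generalizing v with
  | _ d ih =>
    intro hv
    have h1 := h v hv
    rw [map_sum, Finset.sum_eq_single_of_mem v hv, smul_eval] at h1
    · exact (mul_eq_zero.1 h1).resolve_right (hN v).eval_ne_zero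
    · intro u hu huv
      rw [smul_eval]
      by_cases hlt : wt u < wt v
      · rw [ih (wt u) (by omega) u rfl hu, zero_mul]
      · rw [(hN u).eval_eq_zero v (not_lt.1 hlt) huv.symm, mul_zero]

lemma IsSeparating.linearIndependent {N : (Fin (m + 1) → ℕ) → Poly m}
    (hN : ∀ u, IsSeparating q t u (N u)) : LinearIndependent ℂ N :=
  linearIndependent_iff'.2 fun _ _ h => IsSeparating.coeff_eq_zero hN fun v _ => by
    rw [h, map_zero]

lemma IsSeparating.mem_span {N : (Fin (m + 1) → ℕ) → Poly m}
    (hN : ∀ u, IsSeparating q t u (N u)) {d : ℕ} {f : Poly m} (hf : f ∈ degLT m d) :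
    f ∈ Submodule.span ℂ (N '' {v | wt v < d}) := by
  have hmem (v : {v : Fin (m + 1) → ℕ // wt v < d}) : N v ∈ degLT m d :=
    degLT_mono v.2 (hN v).mem_degLT
  let N' : {v : Fin (m + 1) → ℕ // wt v < d} → degLT m d := fun v => ⟨N v, hmem v⟩
  have hli : LinearIndependent ℂ N' := by
    refine LinearIndependent.of_comp (degLT m d).subtype ?_
    exact (IsSeparating.linearIndependent hN).comp _ Subtype.val_injective
  have : FiniteDimensional ℂ (degLT m d) := (degLTBasis m d).finiteDimensional_of_finite
  have hspan := hli.span_eq_top_of_card_eq_finrank'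
    (Module.finrank_eq_card_basis (degLTBasis m d)).symm
  have h1 : (⟨f, hf⟩ : degLT m d) ∈ Submodule.span ℂ (Set.range N') := hspan ▸ Submodule.mem_top
  have h2 := Submodule.mem_map_of_mem (f := (degLT m d).subtype) h1
  rw [Submodule.map_span, ← Set.range_comp] at h2
  refine Submodule.span_mono ?_ h2
  rintro _ ⟨v, rfl⟩
  exact ⟨v, v.2, rfl⟩

/-- A polynomial of degree less than `d` is determined by its values at the spectral vectors of
size less than `d`. -/
lemma eq_zero_of_eval_spec (hg : Generic q t) {d : ℕ} {f : Poly m} (hf : f ∈ degLT m d)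
    (h : ∀ v, wt v < d → eval (spec q t v) f = 0) : f = 0 := by
  choose N hN using exists_isSeparating (m := m) hg
  have h1 := IsSeparating.mem_span hN hf
  obtain ⟨c, hc, rfl⟩ := (Finsupp.mem_span_image_iff_linearCombination ℂ).1 h1
  rw [Finsupp.linearCombination_apply, Finsupp.sum] at h ⊢
  refine Finset.sum_eq_zero fun v hv => ?_
  rw [IsSeparating.coeff_eq_zero hN (c := c) (fun w hw => h w (hc hw)) v hv, zero_smul]

variable {M : (Fin (m + 1) → ℕ) → Poly m}

lemma IsInterpFamily.mem_degLT (hM : IsInterpFamily q t M) (u : Fin (m + 1) → ℕ) :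
    M u ∈ degLT m (wt u + 1) :=
  mem_degLT_of_totalDegree_le (hM u).1

lemma IsInterpFamily.isSeparating (hg : Generic q t) (hM : IsInterpFamily q t M)
    (u : Fin (m + 1) → ℕ) : IsSeparating q t u (M u) where
  mem_degLT := hM.mem_degLT u
  eval_ne_zero h := by
    have h0 : M u = 0 := eq_zero_of_eval_spec hg (hM.mem_degLT u) fun v hv => by
      by_cases hvu : v = u
      · rwa [hvu]
      · exact (hM u).2.2 v (by omega) hvu
    have h1 := (hM u).2.1
    rw [h0, coeff_zero] at h1
    exact inv_ne_zero (pow_ne_zero _ hg.q_ne_zero) h1.symm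
  eval_eq_zero := (hM u).2.2

lemma IsInterpFamily.linearIndependent (hg : Generic q t) (hM : IsInterpFamily q t M) :
    LinearIndependent ℂ M :=
  IsSeparating.linearIndependent (hM.isSeparating hg)

/-- The nonsymmetric Macdonald polynomial `E_u`, the top homogeneous component of `M_u`. -/
def topPart (M : (Fin (m + 1) → ℕ) → Poly m) (u : Fin (m + 1) → ℕ) : Poly m :=
  homogeneousComponent (wt u) (M u)

lemma isHomogeneous_topPart (M : (Fin (m + 1) → ℕ) → Poly m) (u : Fin (m + 1) → ℕ) :
    (topPart M u).IsHomogeneous (wt u) :=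
  homogeneousComponent_isHomogeneous _ _

lemma topPart_mem_degLT (M : (Fin (m + 1) → ℕ) → Poly m) {u : Fin (m + 1) → ℕ} {d : ℕ}
    (h : wt u < d) : topPart M u ∈ degLT m d :=
  mem_degLT_of_isHomogeneous (isHomogeneous_topPart M u) h

lemma IsInterpFamily.sub_topPart_mem_degLT (hM : IsInterpFamily q t M) (u : Fin (m + 1) → ℕ) :
    M u - topPart M u ∈ degLT m (wt u) :=
  sub_homogeneousComponent_mem_degLT (hM.mem_degLT u)

lemma IsInterpFamily.linearIndependent_topPart (hg : Generic q t) (hM : IsInterpFamily q t M) :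
    LinearIndependent ℂ (topPart M) := by
  refine linearIndependent_iff'.2 fun s c h u hu => ?_
  set d := wt u
  have h1 : ∑ v ∈ s with wt v = d, c v • topPart M v = 0 := by
    have := congrArg (homogeneousComponent d) h
    rw [map_sum, map_zero] at this
    rw [Finset.sum_filter]
    refine Eq.trans (Finset.sum_congr rfl fun v _ => ?_) this
    rw [map_smul, homogeneousComponent_of_mem (isHomogeneous_topPart M v)]
    simp only [eq_comm (a := d)]
    split_ifs <;> simp
  have h2 : ∑ v ∈ s with wt v = d, c v • M v = 0 := by
    refine eq_zero_of_eval_spec hg (d := d) ?_ fun w hw => ?_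
    · rw [← sub_zero (∑ v ∈ s with wt v = d, c v • M v), ← h1, ← Finset.sum_sub_distrib]
      refine Submodule.sum_mem _ fun v hv => ?_
      rw [← smul_sub, ← (Finset.mem_filter.1 hv).2]
      exact Submodule.smul_mem _ _ (hM.sub_topPart_mem_degLT v)
    · rw [map_sum]
      refine Finset.sum_eq_zero fun v hv => ?_
      rw [← (Finset.mem_filter.1 hv).2] at hw
      rw [smul_eval, (hM v).2.2 w hw.le (by rintro rfl; omega), mul_zero]
  exact linearIndependent_iff'.1 (hM.linearIndependent hg) _ c h2 u
    (Finset.mem_filter.2 ⟨hu, rfl⟩)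

lemma IsInterpFamily.mem_span_topPart (hg : Generic q t) (hM : IsInterpFamily q t M) {d : ℕ}
    {f : Poly m} (hf : f ∈ degLT m d) : f ∈ Submodule.span ℂ (topPart M '' {v | wt v < d}) := by
  induction d generalizing f with
  | zero => rw [eq_zero_of_mem_degLT_zero hf]; exact Submodule.zero_mem _
  | succ d ih =>
    refine Submodule.span_le.2 ?_ (IsSeparating.mem_span (hM.isSeparating hg) hf)
    rintro _ ⟨u, hu, rfl⟩
    have hud : wt u ≤ d := Nat.lt_succ_iff.1 hu
    rw [← sub_add_cancel (M u) (topPart M u)]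
    refine Submodule.add_mem _ (Submodule.span_mono (Set.image_mono fun v (hv : wt v < d) => ?_)
      (ih (degLT_mono hud (hM.sub_topPart_mem_degLT u))))
      (Submodule.subset_span ⟨u, hu, rfl⟩)
    exact hv.trans (Nat.lt_succ_self d)

lemma exists_mem_degLT (f : Poly m) : ∃ d, f ∈ degLT m d :=
  ⟨_, mem_degLT_of_totalDegree_le le_rfl⟩

/-- The basis `(M_u)`. -/
def interpBasis (hg : Generic q t) (hM : IsInterpFamily q t M) :
    Module.Basis (Fin (m + 1) → ℕ) ℂ (Poly m) :=
  Module.Basis.mk (hM.linearIndependent hg) fun f _ => by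
    obtain ⟨d, hd⟩ := exists_mem_degLT f
    exact Submodule.span_mono (Set.image_subset_range _ _)
      (IsSeparating.mem_span (hM.isSeparating hg) hd)

/-- The basis `(E_u)`. -/
def topBasis (hg : Generic q t) (hM : IsInterpFamily q t M) :
    Module.Basis (Fin (m + 1) → ℕ) ℂ (Poly m) :=
  Module.Basis.mk (hM.linearIndependent_topPart hg) fun f _ => by
    obtain ⟨d, hd⟩ := exists_mem_degLT f
    exact Submodule.span_mono (Set.image_subset_range _ _) (hM.mem_span_topPart hg hd)

lemma interpBasis_apply (hg : Generic q t) (hM : IsInterpFamily q t M) (u : Fin (m + 1) → ℕ) :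
    interpBasis hg hM u = M u := Module.Basis.mk_apply _ _ u

lemma topBasis_apply (hg : Generic q t) (hM : IsInterpFamily q t M) (u : Fin (m + 1) → ℕ) :
    topBasis hg hM u = topPart M u := Module.Basis.mk_apply _ _ u

lemma interpBasis_repr_eq_zero (hg : Generic q t) (hM : IsInterpFamily q t M) {d : ℕ} {f : Poly m}
    (hf : f ∈ degLT m d) {v : Fin (m + 1) → ℕ} (hv : d ≤ wt v) :
    (interpBasis hg hM).repr f v = 0 := by
  have h := IsSeparating.mem_span (hM.isSeparating hg) hf
  rw [show M = interpBasis hg hM from funext fun u => (interpBasis_apply hg hM u).symm,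
    Module.Basis.mem_span_image] at h
  by_contra hne
  exact absurd (h (Finsupp.mem_support_iff.2 hne)) (not_lt.2 hv)

end Interpolation

section Lift

variable {m : ℕ} {q t : ℂ} {M : (Fin (m + 1) → ℕ) → Poly m}

/-- The polynomials vanishing at the spectral vectors of size less than `d`. -/
def vanishing (q t : ℂ) (m d : ℕ) : Submodule ℂ (Poly m) where
  carrier := {f | ∀ v, wt v < d → eval (spec q t v) f = 0}
  zero_mem' v _ := map_zero _
  add_mem' hf hg v hv := by rw [map_add, hf v hv, hg v hv, add_zero]
  smul_mem' c f hf v hv := by rw [smul_eval, hf v hv, mul_zero]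

lemma mem_vanishing {d : ℕ} {f : Poly m} :
    f ∈ vanishing q t m d ↔ ∀ v, wt v < d → eval (spec q t v) f = 0 := Iff.rfl

lemma eq_of_sub_mem (hg : Generic q t) {d : ℕ} {f g : Poly m} (h : f - g ∈ degLT m d)
    (h' : f - g ∈ vanishing q t m d) : f = g :=
  sub_eq_zero.1 (eq_zero_of_eval_spec hg h h')

lemma hecke_mem_vanishing (hg : Generic q t) (i : Fin m) {d : ℕ} {f : Poly m}
    (hf : f ∈ vanishing q t m d) : hecke t i f ∈ vanishing q t m d := fun v hv => by
  rw [eval_spec_hecke hg, hf v hv, hf _ (by rwa [wt_comp_adj]), mul_zero, mul_zero, add_zero]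

lemma heckeProd_mem_vanishing (hg : Generic q t) (j : Fin (m + 1)) {d : ℕ} {f : Poly m}
    (hf : f ∈ vanishing q t m d) : heckeProd t j f ∈ vanishing q t m d := by
  induction j using Fin.reverseInduction with
  | last => rwa [heckeProd_last]
  | cast i ih =>
    rw [heckeProd_castSucc, Module.End.mul_apply]
    exact hecke_mem_vanishing hg i ih

lemma raiseOp_mem_vanishing (hg : Generic q t) {d : ℕ} {f : Poly m}
    (hf : f ∈ vanishing q t m d) : raiseOp q f ∈ vanishing q t m (d + 1) := fun v hv => by
  by_cases h0 : v (Fin.last m) = 0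
  · exact eval_spec_raiseOp_of_eq_zero h0 f
  · obtain ⟨w, rfl⟩ := exists_raise_eq h0
    rw [wt_raise] at hv
    rw [eval_spec_raise_raiseOp hg, hf w (by omega), mul_zero]

lemma IsInterpFamily.mem_vanishing (hM : IsInterpFamily q t M) (u : Fin (m + 1) → ℕ) :
    M u ∈ vanishing q t m (wt u) := fun v hv =>
  (hM u).2.2 v hv.le (by rintro rfl; exact hv.false)

lemma IsInterpFamily.mem_span_topPart_of_isHomogeneous (hg : Generic q t)
    (hM : IsInterpFamily q t M) {d : ℕ} {f : Poly m} (hf : f.IsHomogeneous d) :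
    f ∈ Submodule.span ℂ (topPart M '' {v | wt v = d}) := by
  have h1 := Submodule.mem_map_of_mem (f := homogeneousComponent d)
    (hM.mem_span_topPart hg (mem_degLT_of_isHomogeneous hf d.lt_succ_self))
  rw [homogeneousComponent_of_mem hf, if_pos rfl, Submodule.map_span] at h1
  refine Submodule.span_le.2 ?_ h1
  rintro _ ⟨_, ⟨u, -, rfl⟩, rfl⟩
  rw [homogeneousComponent_of_mem (isHomogeneous_topPart M u)]
  split_ifs with h
  · exact Submodule.subset_span ⟨u, h.symm, rfl⟩
  · exact Submodule.zero_mem _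

/-- The linear isomorphism sending `E_u` to `M_u`. -/
def lift (hg : Generic q t) (hM : IsInterpFamily q t M) : Poly m ≃ₗ[ℂ] Poly m :=
  (topBasis hg hM).equiv (interpBasis hg hM) (Equiv.refl _)

lemma lift_topPart (hg : Generic q t) (hM : IsInterpFamily q t M) (u : Fin (m + 1) → ℕ) :
    lift hg hM (topPart M u) = M u := by
  rw [← topBasis_apply hg hM, lift, Module.Basis.equiv_apply, interpBasis_apply]
  rfl

lemma lift_mem (hg : Generic q t) (hM : IsInterpFamily q t M) {d : ℕ} {f : Poly m}
    (hf : f.IsHomogeneous d) :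
    lift hg hM f - f ∈ degLT m d ∧ lift hg hM f ∈ vanishing q t m d := by
  have h := hM.mem_span_topPart_of_isHomogeneous hg hf
  clear hf
  induction h using Submodule.span_induction with
  | mem f hf =>
    obtain ⟨u, hu, rfl⟩ := hf
    rw [lift_topPart, ← show wt u = d from hu]
    exact ⟨hM.sub_topPart_mem_degLT u, hM.mem_vanishing u⟩
  | zero => simp
  | add f g _ _ hf hg =>
    rw [map_add, add_sub_add_comm]
    exact ⟨Submodule.add_mem _ hf.1 hg.1, Submodule.add_mem _ hf.2 hg.2⟩
  | smul c f _ hf =>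
    rw [map_smul, ← smul_sub]
    exact ⟨Submodule.smul_mem _ c hf.1, Submodule.smul_mem _ c hf.2⟩

lemma lift_eq (hg : Generic q t) (hM : IsInterpFamily q t M) {d : ℕ} {f g : Poly m}
    (hf : f.IsHomogeneous d) (h : g - f ∈ degLT m d) (h' : g ∈ vanishing q t m d) :
    lift hg hM f = g := by
  obtain ⟨h1, h2⟩ := lift_mem hg hM hf
  refine eq_of_sub_mem hg ?_ (Submodule.sub_mem _ h2 h')
  rw [← sub_sub_sub_cancel_right _ _ f]
  exact Submodule.sub_mem _ h1 h

lemma linearMap_ext_topPart (hg : Generic q t) (hM : IsInterpFamily q t M)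
    {A B : Poly m →ₗ[ℂ] Poly m} (h : ∀ u, A (topPart M u) = B (topPart M u)) (f : Poly m) :
    A f = B f :=
  LinearMap.congr_fun ((topBasis hg hM).ext fun u => by rw [topBasis_apply, h]) f

lemma lift_hecke (hg : Generic q t) (hM : IsInterpFamily q t M) (i : Fin m) (f : Poly m) :
    lift hg hM (hecke t i f) = hecke t i (lift hg hM f) := by
  refine linearMap_ext_topPart hg hM (A := (lift hg hM).toLinearMap ∘ₗ hecke t i)
    (B := hecke t i ∘ₗ (lift hg hM).toLinearMap) (fun u => ?_) f
  change lift hg hM (hecke t i _) = hecke t i (lift hg hM _)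
  rw [lift_topPart]
  refine lift_eq hg hM (isHomogeneous_hecke t i (isHomogeneous_topPart M u)) ?_
    (hecke_mem_vanishing hg i (hM.mem_vanishing u))
  rw [← map_sub]
  exact hecke_mem_degLT t i (hM.sub_topPart_mem_degLT u)

lemma lift_heckeProd (hg : Generic q t) (hM : IsInterpFamily q t M) (j : Fin (m + 1))
    (f : Poly m) : lift hg hM (heckeProd t j f) = heckeProd t j (lift hg hM f) := by
  induction j using Fin.reverseInduction with
  | last => simp [heckeProd_last]
  | cast i ih =>
    rw [heckeProd_castSucc, Module.End.mul_apply, Module.End.mul_apply, lift_hecke, ih]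

lemma isHomogeneous_X_mul_rot {d : ℕ} {f : Poly m} (hf : f.IsHomogeneous d) :
    (X (Fin.last m) * rot q f).IsHomogeneous (d + 1) := by
  rw [add_comm d]
  exact (isHomogeneous_X ℂ _).mul (isHomogeneous_rot q hf)

lemma lift_X_mul_rot (hg : Generic q t) (hM : IsInterpFamily q t M) (f : Poly m) :
    lift hg hM (X (Fin.last m) * rot q f) = raiseOp q (lift hg hM f) := by
  have key (u : Fin (m + 1) → ℕ) : lift hg hM (X (Fin.last m) * rot q (topPart M u)) =
      raiseOp q (lift hg hM (topPart M u)) := by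
    rw [lift_topPart]
    refine lift_eq hg hM (isHomogeneous_X_mul_rot (isHomogeneous_topPart M u)) ?_
      (raiseOp_mem_vanishing hg (hM.mem_vanishing u))
    have : raiseOp q (M u) - X (Fin.last m) * rot q (topPart M u) =
        X (Fin.last m) * rot q (M u - topPart M u) - rot q (M u) := by
      rw [raiseOp_apply, map_sub]; ring
    rw [this]
    exact Submodule.sub_mem _ (X_mul_mem_degLT _ (rot_mem_degLT q (hM.sub_topPart_mem_degLT u)))
      (rot_mem_degLT q (hM.mem_degLT u))
  have := linearMap_ext_topPart hg hM
    (A := (lift hg hM).toLinearMap ∘ₗ LinearMap.mulLeft ℂ (X (Fin.last m)) ∘ₗ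
      (rot q).toLinearMap)
    (B := raiseOp q ∘ₗ (lift hg hM).toLinearMap)
    (fun u => by
      simpa only [LinearMap.comp_apply, LinearEquiv.coe_coe, LinearMap.mulLeft_apply,
        AlgHom.toLinearMap_apply] using key u) f
  simpa only [LinearMap.comp_apply, LinearEquiv.coe_coe, LinearMap.mulLeft_apply,
    AlgHom.toLinearMap_apply] using this

lemma lift_X_mul_cher (hg : Generic q t) (hM : IsInterpFamily q t M) (f : Poly m) :
    lift hg hM (X (Fin.last m) * cher q t f) =
      (X (Fin.last m) - 1) * cher q t (lift hg hM f) := by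
  rw [cher_apply, lift_X_mul_rot, lift_heckeProd, raiseOp_apply, cher_apply]

lemma X_last_mul_cher_add_cherQuot (f : Poly m) :
    X (Fin.last m) * (cher q t f + cherQuot q t f) =
      f + raiseOp q (heckeProd t 0 f) := by
  rw [mul_add, X_last_mul_cherQuot, raiseOp_apply, cher_apply]
  ring

lemma spec_last_mul_eval (hg : Generic q t) {d : ℕ} {f : Poly m} (hf : f ∈ vanishing q t m d)
    {v : Fin (m + 1) → ℕ} (hv : wt v ≤ d) :
    spec q t v (Fin.last m) * eval (spec q t v) (cher q t f + cherQuot q t f) =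
      eval (spec q t v) f := by
  have h := congrArg (eval (spec q t v)) (X_last_mul_cher_add_cherQuot (q := q) (t := t) f)
  rwa [map_mul, eval_X, map_add _ f, raiseOp_mem_vanishing hg
    (heckeProd_mem_vanishing hg 0 hf) v (Nat.lt_succ_of_le hv), add_zero] at h

lemma lift_cher (hg : Generic q t) (hM : IsInterpFamily q t M) (f : Poly m) :
    lift hg hM (cher q t f) = cher q t (lift hg hM f) + cherQuot q t (lift hg hM f) := by
  refine linearMap_ext_topPart hg hM (A := (lift hg hM).toLinearMap ∘ₗ cher q t)
    (B := (cher q t + cherQuot q t) ∘ₗ (lift hg hM).toLinearMap) (fun u => ?_) f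
  change lift hg hM (cher q t _) = cher q t (lift hg hM _) + cherQuot q t (lift hg hM _)
  rw [lift_topPart]
  refine lift_eq hg hM (isHomogeneous_cher q t (isHomogeneous_topPart M u)) ?_ fun v hv => ?_
  · rw [add_sub_right_comm, ← map_sub]
    exact Submodule.add_mem _ (cher_mem_degLT q t (hM.sub_topPart_mem_degLT u))
      (cherQuot_mem_degLT q t (hM.mem_degLT u))
  · refine (mul_eq_zero.1 ?_).resolve_left (spec_ne_zero hg v (Fin.last m))
    rw [spec_last_mul_eval hg (hM.mem_vanishing u) hv.le, hM.mem_vanishing u v hv]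

lemma cher_add_cherQuot_interp (hg : Generic q t) (hM : IsInterpFamily q t M)
    (u : Fin (m + 1) → ℕ) :
    cher q t (M u) + cherQuot q t (M u) = (spec q t u (Fin.last m))⁻¹ • M u := by
  refine eq_of_sub_mem hg (d := wt u + 1) ?_ fun v hv => ?_
  · exact Submodule.sub_mem _ (Submodule.add_mem _ (cher_mem_degLT q t (hM.mem_degLT u))
      (degLT_mono (Nat.le_succ _) (cherQuot_mem_degLT q t (hM.mem_degLT u))))
      (Submodule.smul_mem _ _ (hM.mem_degLT u))
  · have h0 := spec_ne_zero hg v (Fin.last m)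
    refine (mul_eq_zero.1 ?_).resolve_left h0
    rw [map_sub, mul_sub, spec_last_mul_eval hg (hM.mem_vanishing u) (Nat.le_of_lt_succ hv),
      smul_eval]
    by_cases hvu : v = u
    · subst hvu
      rw [mul_inv_cancel_left₀ h0, sub_self]
    · rw [(hM u).2.2 v (Nat.le_of_lt_succ hv) hvu]; ring

lemma cher_topPart (hg : Generic q t) (hM : IsInterpFamily q t M) (u : Fin (m + 1) → ℕ) :
    cher q t (topPart M u) = (spec q t u (Fin.last m))⁻¹ • topPart M u := by
  refine (lift hg hM).injective ?_
  rw [lift_cher, map_smul, lift_topPart, cher_add_cherQuot_interp hg hM]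

lemma exists_hecke_topPart (hg : Generic q t) (hM : IsInterpFamily q t M)
    (u : Fin (m + 1) → ℕ) (i : Fin m) : ∃ b : ℂ, (u i.castSucc ≠ u i.succ → b ≠ 0) ∧
      hecke t i (topPart M u) =
        (1 - heckeCoeff q t u i) • topPart M u + b • topPart M (u ∘ adj i) := by
  have hne (v) := (hM.isSeparating hg v).eval_ne_zero
  refine ⟨heckeCoeff q t (u ∘ adj i) i * eval (spec q t u) (M u) /
    eval (spec q t (u ∘ adj i)) (M (u ∘ adj i)), fun hu => ?_, (lift hg hM).injective ?_⟩
  · refine div_ne_zero (mul_ne_zero (heckeCoeff_ne_zero hg ?_) (hne u)) (hne _)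
    simpa using hu.symm
  rw [lift_hecke, map_add, map_smul, map_smul, lift_topPart, lift_topPart]
  refine eq_of_sub_mem hg (d := wt u + 1) ?_ fun v hv => ?_
  · refine Submodule.sub_mem _ (hecke_mem_degLT t i (hM.mem_degLT u)) (Submodule.add_mem _
      (Submodule.smul_mem _ _ (hM.mem_degLT u)) (Submodule.smul_mem _ _ ?_))
    rw [← wt_comp_adj u i]
    exact hM.mem_degLT _
  rw [map_sub, map_add, eval_spec_hecke hg, smul_eval, smul_eval]
  have hv' := Nat.le_of_lt_succ hv
  by_cases hu : u i.castSucc = u i.succ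
  · simp only [comp_adj_of_eq hu, heckeCoeff_of_eq hg hu, zero_mul, zero_div, add_zero, sub_zero]
    by_cases hvu : v = u
    · rw [hvu, heckeCoeff_of_eq hg hu]; ring
    · rw [(hM u).2.2 v hv' hvu, (hM u).2.2 (v ∘ adj i) (by rwa [wt_comp_adj])
        fun h => hvu (by rw [← comp_adj_comp_adj v i, h, comp_adj_of_eq hu])]
      ring
  have hs : u ∘ adj i ≠ u := fun h => hu (by simpa using (congrFun h i.castSucc).symm)
  by_cases hvu : v = u
  · subst hvu
    rw [(hM v).2.2 _ (wt_comp_adj v i).le hs, (hM _).2.2 v (wt_comp_adj v i).ge hs.symm]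
    ring
  by_cases hvs : v = u ∘ adj i
  · subst hvs
    rw [comp_adj_comp_adj, (hM u).2.2 _ (wt_comp_adj u i).le hs, div_mul_cancel₀ _ (hne _)]
    ring
  · rw [(hM u).2.2 v hv' hvu, (hM _).2.2 v (by rwa [wt_comp_adj]) hvs,
      (hM u).2.2 (v ∘ adj i) (by rwa [wt_comp_adj])
        fun h => hvs (by rw [← h, comp_adj_comp_adj])]
    ring

lemma exists_X_mul_rot_topPart (hg : Generic q t) (hM : IsInterpFamily q t M)
    (u : Fin (m + 1) → ℕ) : ∃ c : ℂ, c ≠ 0 ∧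
      X (Fin.last m) * rot q (topPart M u) = c • topPart M (raise u) := by
  have hne (v) := (hM.isSeparating hg v).eval_ne_zero
  have h0 : spec q t (raise u) (Fin.last m) - 1 ≠ 0 :=
    spec_last_sub_one_ne_zero hg (by rw [raise_last]; omega)
  refine ⟨(spec q t (raise u) (Fin.last m) - 1) * eval (spec q t u) (M u) /
    eval (spec q t (raise u)) (M (raise u)), div_ne_zero (mul_ne_zero h0 (hne u)) (hne _),
    (lift hg hM).injective ?_⟩
  rw [lift_X_mul_rot, map_smul, lift_topPart, lift_topPart]
  refine eq_of_sub_mem hg (d := wt u + 1 + 1) ?_ fun v hv => ?_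
  · refine Submodule.sub_mem _ (raiseOp_mem_degLT (hM.mem_degLT u)) (Submodule.smul_mem _ _ ?_)
    rw [← wt_raise u]
    exact hM.mem_degLT _
  rw [map_sub, smul_eval]
  by_cases hvu : v = raise u
  · rw [hvu, eval_spec_raise_raiseOp hg, div_mul_cancel₀ _ (hne _), sub_self]
  rw [(hM (raise u)).2.2 v (by rw [wt_raise]; omega) hvu, mul_zero, sub_zero]
  by_cases hv0 : v (Fin.last m) = 0
  · exact eval_spec_raiseOp_of_eq_zero hv0 _
  · obtain ⟨w, rfl⟩ := exists_raise_eq hv0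
    rw [wt_raise] at hv
    rw [eval_spec_raise_raiseOp hg, (hM u).2.2 w (by omega) fun h => hvu (by rw [h]), mul_zero]

/-- The conjugate of `lift` by the dilation by `z`. -/
def liftAt (hg : Generic q t) (hM : IsInterpFamily q t M) (z : ℂ) : Module.End ℂ (Poly m) :=
  (dil z⁻¹).toLinearMap ∘ₗ (lift hg hM).toLinearMap ∘ₗ (dil z).toLinearMap

lemma liftAt_apply (hg : Generic q t) (hM : IsInterpFamily q t M) (z : ℂ) (f : Poly m) :
    liftAt hg hM z f = dil z⁻¹ (lift hg hM (dil z f)) := rfl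

lemma liftAt_hecke (hg : Generic q t) (hM : IsInterpFamily q t M) {z : ℂ} (hz : z ≠ 0)
    (i : Fin m) (f : Poly m) :
    liftAt hg hM z (hecke t i f) = hecke t i (liftAt hg hM z f) := by
  rw [liftAt_apply, liftAt_apply, dil_hecke hz, lift_hecke, dil_hecke (inv_ne_zero hz)]

lemma liftAt_heckeProd (hg : Generic q t) (hM : IsInterpFamily q t M) {z : ℂ} (hz : z ≠ 0)
    (j : Fin (m + 1)) (f : Poly m) :
    liftAt hg hM z (heckeProd t j f) = heckeProd t j (liftAt hg hM z f) := by
  rw [liftAt_apply, liftAt_apply, dil_heckeProd hz, lift_heckeProd, dil_heckeProd (inv_ne_zero hz)]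

lemma liftAt_X_mul_cher (hg : Generic q t) (hM : IsInterpFamily q t M) {z : ℂ} (hz : z ≠ 0)
    (f : Poly m) : liftAt hg hM z (X (Fin.last m) * cher q t f) =
      X (Fin.last m) * cher q t (liftAt hg hM z f) - z • cher q t (liftAt hg hM z f) := by
  rw [liftAt_apply, liftAt_apply, map_mul, dil_X, dil_cher hz, mul_assoc, ← smul_eq_C_mul,
    map_smul, lift_X_mul_cher, map_smul, map_mul, map_sub, map_one, dil_X,
    dil_cher (inv_ne_zero hz), smul_eq_C_mul, smul_eq_C_mul]
  have : (C z * C z⁻¹ : Poly m) = 1 := by rw [← C_mul, mul_inv_cancel₀ hz, C_1]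
  linear_combination (X (Fin.last m) * cher q t (dil z⁻¹ (lift hg hM (dil z f)))) * this

lemma liftAt_cher (hg : Generic q t) (hM : IsInterpFamily q t M) {z : ℂ} (hz : z ≠ 0)
    (f : Poly m) : liftAt hg hM z (cher q t f) =
      cher q t (liftAt hg hM z f) + z • cherQuot q t (liftAt hg hM z f) := by
  rw [liftAt_apply, liftAt_apply, dil_cher hz, lift_cher, map_add, dil_cher (inv_ne_zero hz),
    cherQuot_dil (inv_ne_zero hz), ← smul_eq_C_mul, smul_smul, mul_inv_cancel₀ hz, one_smul]

lemma liftAt_liftAt_X_mul_cher (hg : Generic q t) (hM : IsInterpFamily q t M) {y z : ℂ}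
    (hy : y ≠ 0) (hz : z ≠ 0) (f : Poly m) :
    liftAt hg hM y (liftAt hg hM z (X (Fin.last m) * cher q t f)) =
      X (Fin.last m) * cher q t (liftAt hg hM y (liftAt hg hM z f)) -
        (y + z) • cher q t (liftAt hg hM y (liftAt hg hM z f)) -
        (y * z) • cherQuot q t (liftAt hg hM y (liftAt hg hM z f)) := by
  rw [liftAt_X_mul_cher hg hM hz, map_sub, map_smul, liftAt_X_mul_cher hg hM hy,
    liftAt_cher hg hM hy]
  simp only [smul_add, add_smul, smul_smul, mul_comm z y]
  abel

lemma liftAt_C (hg : Generic q t) (hM : IsInterpFamily q t M) (z a : ℂ) :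
    liftAt hg hM z (C a) = C a := by
  have : lift hg hM (C a) = C a := by
    refine lift_eq hg hM (isHomogeneous_C _ a) ?_ fun v hv => absurd hv (Nat.not_lt_zero _)
    rw [sub_self]
    exact Submodule.zero_mem _
  rw [liftAt_apply, dil_C, this, dil_C]

lemma commute_liftAt (hg : Generic q t) (hM : IsInterpFamily q t M) {y z : ℂ} (hy : y ≠ 0)
    (hz : z ≠ 0) : Commute (liftAt hg hM y) (liftAt hg hM z) := by
  refine (topBasis hg hM).ext fun u => ?_
  rw [topBasis_apply, Module.End.mul_apply, Module.End.mul_apply]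
  induction u using composition_induction with
  | zero =>
    have h0 : (topPart M 0).IsHomogeneous 0 := by
      simpa only [wt_zero] using isHomogeneous_topPart M 0
    rw [totalDegree_eq_zero_iff_eq_C.1 ((totalDegree_zero_iff_isHomogeneous _).2 h0)]
    simp only [liftAt_C]
  | raise u ih =>
    obtain ⟨W, hW⟩ := isUnit_heckeProd hg.t_ne_zero (m := m) 0
    have hWinj : Function.Injective (heckeProd t (0 : Fin (m + 1))) := fun f g h => by
      rw [← hW] at h
      have := congrArg (↑W⁻¹ : Module.End ℂ (Poly m)) h
      rwa [← Module.End.mul_apply, ← Module.End.mul_apply, W.inv_mul] at this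
    obtain ⟨f, hf⟩ : ∃ f, heckeProd t 0 f = topPart M u :=
      ⟨(↑W⁻¹ : Module.End ℂ (Poly m)) (topPart M u), by
        rw [← hW, ← Module.End.mul_apply, W.mul_inv]; rfl⟩
    obtain ⟨c, hc, hcu⟩ := exists_X_mul_rot_topPart hg hM u
    rw [← hf] at ih
    simp only [liftAt_heckeProd hg hM hy, liftAt_heckeProd hg hM hz] at ih
    have h1 := liftAt_liftAt_X_mul_cher hg hM hy hz f
    rw [hWinj ih, add_comm y, mul_comm y, ← liftAt_liftAt_X_mul_cher hg hM hz hy f, cher_apply,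
      hf, hcu] at h1
    simp only [map_smul] at h1
    exact smul_right_injective _ hc h1
  | adj u i ih =>
    by_cases hu : u i.castSucc = u i.succ
    · rwa [comp_adj_of_eq hu]
    obtain ⟨b, hb, hbu⟩ := exists_hecke_topPart hg hM u i
    have h1 : liftAt hg hM y (liftAt hg hM z (hecke t i (topPart M u))) =
        liftAt hg hM z (liftAt hg hM y (hecke t i (topPart M u))) := by
      simp only [liftAt_hecke hg hM hy, liftAt_hecke hg hM hz, ih]
    rw [hbu] at h1
    simp only [map_smul, map_add, ih] at h1
    exact smul_right_injective _ (hb hu) (add_left_cancel h1)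

end Lift

section Duality

variable {m : ℕ} {q t : ℂ} {M : (Fin (m + 1) → ℕ) → Poly m}

/-- Evaluation at the spectral vector `⟨u⟩`, as a linear form. -/
def evalSpec (q t : ℂ) (u : Fin (m + 1) → ℕ) : Poly m →ₗ[ℂ] ℂ :=
  (aeval (spec q t u)).toLinearMap

lemma evalSpec_apply (u : Fin (m + 1) → ℕ) (f : Poly m) :
    evalSpec q t u f = eval (spec q t u) f :=
  RingHom.congr_fun (coe_aeval_eq_eval _) f

/-- The principal specialization `E_u(⟨0⟩)`. -/
def prin (q t : ℂ) (M : (Fin (m + 1) → ℕ) → Poly m) (u : Fin (m + 1) → ℕ) : ℂ :=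
  eval (spec q t 0) (topPart M u)

/-- A linear form `ℓ` and a polynomial `p` are adjoint if `ℓ(E_u) = E_u(⟨0⟩) p(⟨u⟩)` for all
compositions `u`. -/
def IsAdj (q t : ℂ) (M : (Fin (m + 1) → ℕ) → Poly m) (ℓ : Poly m →ₗ[ℂ] ℂ) (p : Poly m) : Prop :=
  ∀ u, ℓ (topPart M u) = prin q t M u * eval (spec q t u) p

lemma IsAdj.comp_hecke (hg : Generic q t) (hM : IsInterpFamily q t M) {ℓ : Poly m →ₗ[ℂ] ℂ}
    {p : Poly m} (h : IsAdj q t M ℓ p) (i : Fin m) :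
    IsAdj q t M (ℓ ∘ₗ hecke t i) (hecke t i p) := fun u => by
  obtain ⟨b, -, hb⟩ := exists_hecke_topPart hg hM u i
  have h0 : b * prin q t M (u ∘ adj i) = heckeCoeff q t u i * prin q t M u := by
    have h1 := congrArg (eval (spec q t 0)) hb
    rw [eval_spec_hecke hg, heckeCoeff_of_eq hg (by rfl), map_add, smul_eval, smul_eval] at h1
    change _ * prin q t M u + _ = _ * prin q t M u + _ * prin q t M (u ∘ adj i) at h1
    linear_combination -h1
  rw [LinearMap.comp_apply, hb, map_add, map_smul, map_smul, h, h, eval_spec_hecke hg,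
    smul_eq_mul, smul_eq_mul]
  linear_combination eval (spec q t (u ∘ adj i)) p * h0

lemma IsAdj.exists_comp_heckeProd (hg : Generic q t) (hM : IsInterpFamily q t M) {d : ℕ}
    (j : Fin (m + 1)) {ℓ : Poly m →ₗ[ℂ] ℂ} {p : Poly m} (hp : p ∈ degLT m d)
    (h : IsAdj q t M ℓ p) : ∃ p' ∈ degLT m d, IsAdj q t M (ℓ ∘ₗ heckeProd t j) p' := by
  induction j using Fin.reverseInduction generalizing ℓ p with
  | last => exact ⟨p, hp, by rwa [heckeProd_last]⟩
  | cast i ih =>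
    rw [heckeProd_castSucc]
    exact ih (hecke_mem_degLT t i hp) (h.comp_hecke hg hM i)

lemma exists_isAdj_evalSpec (hg : Generic q t) (hM : IsInterpFamily q t M)
    (w : Fin (m + 1) → ℕ) : ∃ p ∈ degLT m (wt w + 1), IsAdj q t M (evalSpec q t w) p := by
  induction w using composition_induction with
  | zero =>
    refine ⟨1, mem_degLT_of_isHomogeneous (isHomogeneous_one _ _) (Nat.succ_pos _), fun u => ?_⟩
    rw [evalSpec_apply, map_one, mul_one]
    rfl
  | raise w ih =>
    obtain ⟨p, hp, h⟩ := ih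
    obtain ⟨p', hp', h'⟩ := h.exists_comp_heckeProd hg hM 0 hp
    refine ⟨X (Fin.last m) * p', ?_, fun u => ?_⟩
    · rw [wt_raise]
      exact X_mul_mem_degLT _ hp'
    · have h1 := h' u
      rw [LinearMap.comp_apply, evalSpec_apply, ← eval_spec_raise_rot hg w, ← cher_apply,
        cher_topPart hg hM, smul_eval,
        inv_mul_eq_iff_eq_mul₀ (spec_ne_zero hg u (Fin.last m))] at h1
      rw [evalSpec_apply, h1, map_mul, eval_X]
      ring
  | adj w i ih =>
    by_cases hw : w i.castSucc = w i.succ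
    · rwa [comp_adj_of_eq hw]
    obtain ⟨p, hp, h⟩ := ih
    have hne := heckeCoeff_ne_zero hg hw
    refine ⟨(heckeCoeff q t w i)⁻¹ • (hecke t i p - (1 - heckeCoeff q t w i) • p), ?_,
      fun u => ?_⟩
    · rw [wt_comp_adj]
      exact Submodule.smul_mem _ _ (Submodule.sub_mem _ (hecke_mem_degLT t i hp)
        (Submodule.smul_mem _ _ hp))
    · have h1 := h.comp_hecke hg hM i u
      have h2 := h u
      rw [LinearMap.comp_apply, evalSpec_apply, eval_spec_hecke hg] at h1
      rw [evalSpec_apply] at h2 ⊢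
      refine mul_left_cancel₀ hne ?_
      rw [smul_eval, map_sub, smul_eval]
      linear_combination h1 - (1 - heckeCoeff q t w i) * h2 - prin q t M u *
        (eval (spec q t u) (hecke t i p) - (1 - heckeCoeff q t w i) * eval (spec q t u) p) *
          mul_inv_cancel₀ hne

lemma prin_ne_zero (hg : Generic q t) (hM : IsInterpFamily q t M) (u : Fin (m + 1) → ℕ) :
    prin q t M u ≠ 0 := fun h => by
  refine (hM.linearIndependent_topPart hg).ne_zero u
    (eq_zero_of_eval_spec hg (topPart_mem_degLT M (Nat.lt_succ_self _)) fun w _ => ?_)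
  obtain ⟨p, -, hp⟩ := exists_isAdj_evalSpec hg hM w
  rw [← evalSpec_apply, hp u, h, zero_mul]

lemma evalSpec_eq_sum_coord (hg : Generic q t) (hM : IsInterpFamily q t M)
    (v : Fin (m + 1) → ℕ) : evalSpec q t v =
      eval (spec q t v) (M v) • (interpBasis hg hM).coord v +
        ∑ u ∈ (finite_setOf_wt_lt (wt v)).toFinset,
          eval (spec q t v) (M u) • (interpBasis hg hM).coord u := by
  refine (interpBasis hg hM).ext fun w => ?_
  simp only [LinearMap.add_apply, LinearMap.sum_apply, LinearMap.smul_apply,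
    Module.Basis.coord_apply, Module.Basis.repr_self, Finsupp.single_apply, smul_eq_mul, mul_ite,
    mul_one, mul_zero, Finset.sum_ite_eq, Set.Finite.mem_toFinset, Set.mem_ofPred_eq]
  rw [evalSpec_apply, interpBasis_apply]
  by_cases hwv : w = v
  · simp [hwv]
  · by_cases hlt : wt w < wt v
    · simp [hwv, hlt]
    · simp [hwv, hlt, (hM w).2.2 v (not_lt.1 hlt) (Ne.symm hwv)]

lemma exists_isAdj_coord (hg : Generic q t) (hM : IsInterpFamily q t M) (v : Fin (m + 1) → ℕ) :
    ∃ p ∈ degLT m (wt v + 1), IsAdj q t M ((interpBasis hg hM).coord v) p := by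
  induction hd : wt v using Nat.strong_induction_on generalizing v with
  | _ d ih =>
    subst hd
    have ih' (u : Fin (m + 1) → ℕ) : ∃ p, wt u < wt v →
        p ∈ degLT m (wt u + 1) ∧ IsAdj q t M ((interpBasis hg hM).coord u) p := by
      by_cases h : wt u < wt v
      · obtain ⟨p, hp⟩ := ih _ h u rfl
        exact ⟨p, fun _ => hp⟩
      · exact ⟨0, fun h' => absurd h' h⟩
    choose P hP using ih'
    obtain ⟨p, hp, hpv⟩ := exists_isAdj_evalSpec hg hM v
    have hne := (hM.isSeparating hg v).eval_ne_zero
    set s := (finite_setOf_wt_lt (m := m) (wt v)).toFinset with hs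
    have hmem {u} (hu : u ∈ s) : wt u < wt v := by
      rw [hs, Set.Finite.mem_toFinset] at hu
      exact hu
    refine ⟨(eval (spec q t v) (M v))⁻¹ • (p - ∑ u ∈ s, eval (spec q t v) (M u) • P u), ?_,
      fun u => ?_⟩
    · refine Submodule.smul_mem _ _ (Submodule.sub_mem _ hp (Submodule.sum_mem _ fun u hu => ?_))
      exact Submodule.smul_mem _ _ (degLT_mono (Nat.succ_le_succ (hmem hu).le)
        (hP u (hmem hu)).1)
    · have h1 := hpv u
      rw [evalSpec_eq_sum_coord hg hM v, LinearMap.add_apply, LinearMap.sum_apply] at h1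
      simp only [LinearMap.smul_apply, smul_eq_mul] at h1
      refine mul_left_cancel₀ hne ?_
      rw [eq_sub_of_add_eq h1, smul_eval, map_sub, map_sum,
        mul_left_comm _ (prin q t M u), mul_inv_cancel_left₀ hne, mul_sub, Finset.mul_sum]
      refine congrArg _ (Finset.sum_congr rfl fun w hw => ?_)
      rw [(hP w (hmem hw)).2 u, smul_eval]
      ring

/-- The coefficient of `M_v` in `E_u`. -/
lemma repr_topPart (hg : Generic q t) (hM : IsInterpFamily q t M) (u v : Fin (m + 1) → ℕ) :
    (interpBasis hg hM).repr (topPart M u) v = prin q t M u / prin q t M v *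
      (eval (spec q t u) (M v) / eval (spec q t v) (M v)) := by
  obtain ⟨p, hp, hpv⟩ := exists_isAdj_coord hg hM v
  have hM0 := (hM.isSeparating hg v).eval_ne_zero
  have he := prin_ne_zero hg hM
  have hcoord (u : Fin (m + 1) → ℕ) (hu : wt u ≤ wt v) :
      (interpBasis hg hM).coord v (topPart M u) = if u = v then 1 else 0 := by
    have h1 : (interpBasis hg hM).repr (M u - topPart M u) v = 0 :=
      interpBasis_repr_eq_zero hg hM (hM.sub_topPart_mem_degLT u) hu
    rw [map_sub, Finsupp.sub_apply, sub_eq_zero] at h1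
    rw [Module.Basis.coord_apply, ← h1, ← interpBasis_apply hg hM, Module.Basis.repr_self,
      Finsupp.single_apply]
  have hp' : p = (prin q t M v * eval (spec q t v) (M v))⁻¹ • M v := by
    refine eq_of_sub_mem hg (Submodule.sub_mem _ hp (Submodule.smul_mem _ _ (hM.mem_degLT v)))
      fun u hu => ?_
    have hu' := Nat.le_of_lt_succ hu
    have h1 := hpv u
    rw [hcoord u hu'] at h1
    rw [map_sub, smul_eval]
    by_cases huv : u = v
    · subst huv
      rw [if_pos rfl] at h1
      rw [mul_inv, mul_assoc, inv_mul_cancel₀ hM0, eq_inv_of_mul_eq_one_right h1.symm]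
      ring
    · rw [if_neg huv, zero_eq_mul] at h1
      rw [h1.resolve_left (he u), (hM v).2.2 u hu' huv]
      ring
  have h2 := hpv u
  rw [Module.Basis.coord_apply] at h2
  rw [h2, hp', smul_eval, mul_inv]
  ring

end Duality

section Extraction

variable {m : ℕ}

/-- The finite set of compositions of size at most `|u|`. -/
def below (u : Fin (m + 1) → ℕ) : Finset (Fin (m + 1) → ℕ) :=
  (finite_setOf_wt_lt (wt u + 1)).toFinset

lemma mem_below {u v : Fin (m + 1) → ℕ} : v ∈ below u ↔ wt v ≤ wt u := by
  rw [below, Set.Finite.mem_toFinset]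
  exact Nat.lt_succ_iff

lemma finsum_cond_eq_sum_ite {ι : Type*} {s : Finset ι} {f : ι → ℂ} (hf : ∀ i, i ∉ s → f i = 0)
    (p : ι → Prop) [DecidablePred p] :
    ∑ᶠ (i) (_ : p i), f i = ∑ i ∈ s, if p i then f i else 0 := by
  simp only [finsum_eq_if]
  refine finsum_eq_sum_of_support_subset _ fun i hi => ?_
  by_contra his
  refine hi ?_
  simp only [hf i his, ite_self]

lemma finsum_eq_finsum_of_forall {x y : (Fin (m + 1) → ℕ) → (Fin (m + 1) → ℕ) → ℂ}
    (hx : ∀ u v, wt u < wt v → x u v = 0) (hy : ∀ u v, wt u < wt v → y u v = 0)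
    (u w : Fin (m + 1) → ℕ)
    (h : ∀ z : ℂ, z ≠ 0 → ∑ v ∈ below u, z⁻¹ ^ wt v * z ^ wt u * (x u v * y v w) =
      ∑ v ∈ below u, z⁻¹ ^ wt w * z ^ wt v * (y u v * x v w)) (k : ℕ) :
    ∑ᶠ (v : Fin (m + 1) → ℕ) (_ : wt v = k), x u v * y v w =
      ∑ᶠ (v : Fin (m + 1) → ℕ) (_ : (wt v : ℤ) = (wt u : ℤ) + (wt w : ℤ) - (k : ℤ)),
        y u v * x v w := by
  have hpoly : ∑ v ∈ below u, Polynomial.C (x u v * y v w) * Polynomial.X ^ (wt u - wt v) =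
      ∑ v ∈ below u, Polynomial.C (y u v * x v w) * Polynomial.X ^ (wt v - wt w) := by
    refine mul_left_cancel₀ Polynomial.X_ne_zero (Polynomial.funext fun z => ?_)
    by_cases hz : z = 0
    · simp [hz]
    simp only [Polynomial.eval_mul, Polynomial.eval_finsetSum, Polynomial.eval_pow,
      Polynomial.eval_X, Polynomial.eval_C]
    congr 1
    refine Eq.trans (Finset.sum_congr rfl fun v hv => ?_)
      ((h z hz).trans (Finset.sum_congr rfl fun v hv => ?_))
    · rw [pow_sub₀ _ hz (mem_below.1 hv), inv_pow]
      ring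
    · by_cases hvw : wt v < wt w
      · rw [hx v w hvw]; ring
      · rw [pow_sub₀ _ hz (not_lt.1 hvw), inv_pow]
        ring
  rw [finsum_cond_eq_sum_ite (s := below u) fun v hv => by
      rw [hx u v (not_le.1 fun h => hv (mem_below.2 h)), zero_mul],
    finsum_cond_eq_sum_ite (s := below u) fun v hv => by
      rw [hy u v (not_le.1 fun h => hv (mem_below.2 h)), zero_mul]]
  by_cases hk : k ≤ wt u
  · have hcoeff := congrArg (fun p => Polynomial.coeff p (wt u - k)) hpoly
    simp only [Polynomial.finsetSum_coeff, Polynomial.coeff_C_mul_X_pow] at hcoeff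
    refine Eq.trans (Finset.sum_congr rfl fun v hv => ?_)
      (hcoeff.trans (Finset.sum_congr rfl fun v hv => ?_))
    · have := mem_below.1 hv
      exact if_congr (by omega) rfl rfl
    · by_cases hvw : wt v < wt w
      · rw [hx v w hvw, mul_zero, ite_self, ite_self]
      · exact if_congr (by omega) rfl rfl
  · rw [Finset.sum_eq_zero, Finset.sum_eq_zero]
    · intro v _
      split_ifs with hvk
      · rw [hx v w (by omega), mul_zero]
      · rfl
    · intro v hv
      have := mem_below.1 hv
      rw [if_neg (by omega)]

variable {q t : ℂ} {M : (Fin (m + 1) → ℕ) → Poly m}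

/-- The matrix entries of an endomorphism in the basis `(E_u)`. -/
def entry (hg : Generic q t) (hM : IsInterpFamily q t M) (A : Module.End ℂ (Poly m))
    (u v : Fin (m + 1) → ℕ) : ℂ :=
  (topBasis hg hM).repr (A (topPart M u)) v

lemma repr_dil (hg : Generic q t) (hM : IsInterpFamily q t M) (z : ℂ) (f : Poly m)
    (v : Fin (m + 1) → ℕ) :
    (topBasis hg hM).repr (dil z f) v = z ^ wt v * (topBasis hg hM).repr f v := by
  have : (topBasis hg hM).coord v ∘ₗ (dil z).toLinearMap = z ^ wt v • (topBasis hg hM).coord v := by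
    refine (topBasis hg hM).ext fun u => ?_
    rw [LinearMap.comp_apply, LinearMap.smul_apply, AlgHom.toLinearMap_apply, topBasis_apply,
      dil_of_isHomogeneous (isHomogeneous_topPart M u), map_smul, ← topBasis_apply hg hM,
      Module.Basis.coord_apply, Module.Basis.repr_self, Finsupp.single_apply]
    split_ifs with h
    · rw [h]
    · rw [smul_zero, smul_zero]
  exact LinearMap.congr_fun this f

lemma repr_apply_eq_sum (hg : Generic q t) (hM : IsInterpFamily q t M)
    (A : Module.End ℂ (Poly m)) {s : Finset (Fin (m + 1) → ℕ)} {f : Poly m}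
    (hf : ∀ v, v ∉ s → (topBasis hg hM).repr f v = 0) (w : Fin (m + 1) → ℕ) :
    (topBasis hg hM).repr (A f) w =
      ∑ v ∈ s, (topBasis hg hM).repr f v * entry hg hM A v w := by
  have hs : ((topBasis hg hM).repr f).support ⊆ s := fun v hv => by
    by_contra h
    exact Finsupp.mem_support_iff.1 hv (hf v h)
  have h1 : f = ∑ v ∈ s, (topBasis hg hM).repr f v • topPart M v := by
    conv_lhs => rw [← (topBasis hg hM).linearCombination_repr f, Finsupp.linearCombination_apply,
      Finsupp.sum_of_support_subset _ hs (fun i a => a • topBasis hg hM i)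
        fun _ _ => zero_smul _ _]
    simp only [topBasis_apply]
  conv_lhs => rw [h1]
  simp only [map_sum, map_smul, Finsupp.finsetSum_apply, Finsupp.smul_apply, smul_eq_mul]
  rfl

/-- If all dilates of `A` commute with `B`, where `A` and `B` are triangular in the basis `(E_u)`,
then the sums over compositions of fixed size defining the products of their matrices, up to
rescaling of the basis, agree. -/
lemma finsum_entry_mul_entry (hg : Generic q t) (hM : IsInterpFamily q t M)
    {A B : Module.End ℂ (Poly m)} {ρ : (Fin (m + 1) → ℕ) → ℂ} (hρ : ∀ u, ρ u ≠ 0)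
    {x y : (Fin (m + 1) → ℕ) → (Fin (m + 1) → ℕ) → ℂ}
    (hxA : ∀ u v, x u v = ρ u / ρ v * entry hg hM A u v)
    (hyB : ∀ u v, y u v = ρ u / ρ v * entry hg hM B u v)
    (hA : ∀ u v, wt u < wt v → entry hg hM A u v = 0)
    (hB : ∀ u v, wt u < wt v → entry hg hM B u v = 0)
    (h : ∀ z : ℂ, z ≠ 0 → ∀ f, dil z⁻¹ (A (dil z (B f))) = B (dil z⁻¹ (A (dil z f))))
    (u w : Fin (m + 1) → ℕ) (k : ℕ) :
    ∑ᶠ (v : Fin (m + 1) → ℕ) (_ : wt v = k), x u v * y v w =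
      ∑ᶠ (v : Fin (m + 1) → ℕ) (_ : (wt v : ℤ) = (wt u : ℤ) + (wt w : ℤ) - (k : ℤ)),
        y u v * x v w := by
  refine finsum_eq_finsum_of_forall (fun u v huv => by rw [hxA, hA u v huv, mul_zero])
    (fun u v huv => by rw [hyB, hB u v huv, mul_zero]) u w (fun z hz => ?_) k
  let A' : Module.End ℂ (Poly m) := (dil z⁻¹).toLinearMap ∘ₗ A ∘ₗ (dil z).toLinearMap
  have hA' (u v : Fin (m + 1) → ℕ) :
      entry hg hM A' u v = z⁻¹ ^ wt v * z ^ wt u * entry hg hM A u v := by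
    change (topBasis hg hM).repr (dil z⁻¹ (A (dil z (topPart M u)))) v = _
    rw [repr_dil, dil_of_isHomogeneous (isHomogeneous_topPart M u), map_smul, map_smul,
      Finsupp.smul_apply, smul_eq_mul, mul_assoc]
    rfl
  have hnot {v : Fin (m + 1) → ℕ} (hv : v ∉ below u) : wt u < wt v :=
    not_le.1 fun h => hv (mem_below.2 h)
  have h1 := congrArg (fun f => (topBasis hg hM).repr f w) (h z hz (topPart M u))
  change (topBasis hg hM).repr (A' (B (topPart M u))) w =
    (topBasis hg hM).repr (B (A' (topPart M u))) w at h1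
  rw [repr_apply_eq_sum hg hM A' (s := below u) (fun v hv => hB u v (hnot hv)),
    repr_apply_eq_sum hg hM B (s := below u)
      (fun v hv => (hA' u v).trans (by rw [hA u v (hnot hv), mul_zero]))] at h1
  have h2 := congrArg (ρ u / ρ w * ·) h1
  simp only [Finset.mul_sum] at h2
  refine Eq.trans (Finset.sum_congr rfl fun v _ => ?_)
    (h2.symm.trans (Finset.sum_congr rfl fun v _ => ?_))
  · change _ = ρ u / ρ w * (entry hg hM A' u v * entry hg hM B v w)
    rw [hA', hxA, hyB]
    have := hρ v
    field_simp
  · change ρ u / ρ w * (entry hg hM B u v * entry hg hM A' v w) = _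
    rw [hA', hxA, hyB]
    have := hρ v
    field_simp

end Extraction

section Operators

variable {m : ℕ} {q t : ℂ} {M : (Fin (m + 1) → ℕ) → Poly m}

lemma dil_inv_dil {z : ℂ} (hz : z ≠ 0) (f : Poly m) : dil z⁻¹ (dil z f) = f := by
  rw [dil_dil, inv_mul_cancel₀ hz, dil_one]

lemma dil_dil_inv {z : ℂ} (hz : z ≠ 0) (f : Poly m) : dil z (dil z⁻¹ f) = f := by
  rw [dil_dil, mul_inv_cancel₀ hz, dil_one]

/-- `liftAt` as a unit. -/
def liftUnit (hg : Generic q t) (hM : IsInterpFamily q t M) {z : ℂ} (hz : z ≠ 0) :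
    (Module.End ℂ (Poly m))ˣ where
  val := liftAt hg hM z
  inv := (dil z⁻¹).toLinearMap ∘ₗ (lift hg hM).symm.toLinearMap ∘ₗ (dil z).toLinearMap
  val_inv := LinearMap.ext fun f => by
    change dil z⁻¹ (lift hg hM (dil z (dil z⁻¹ ((lift hg hM).symm (dil z f))))) = f
    rw [dil_dil_inv hz, LinearEquiv.apply_symm_apply, dil_inv_dil hz]
  inv_val := LinearMap.ext fun f => by
    change dil z⁻¹ ((lift hg hM).symm (dil z (dil z⁻¹ (lift hg hM (dil z f))))) = f
    rw [dil_dil_inv hz, LinearEquiv.symm_apply_apply, dil_inv_dil hz]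

lemma coe_liftUnit (hg : Generic q t) (hM : IsInterpFamily q t M) {z : ℂ} (hz : z ≠ 0) :
    (liftUnit hg hM hz : Module.End ℂ (Poly m)) = liftAt hg hM z := rfl

lemma liftUnit_inv_apply (hg : Generic q t) (hM : IsInterpFamily q t M) {z : ℂ} (hz : z ≠ 0)
    (f : Poly m) : (↑(liftUnit hg hM hz)⁻¹ : Module.End ℂ (Poly m)) f =
      dil z⁻¹ ((lift hg hM).symm (dil z f)) := rfl

lemma commute_liftUnit (hg : Generic q t) (hM : IsInterpFamily q t M) {y z : ℂ} (hy : y ≠ 0)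
    (hz : z ≠ 0) : Commute (liftUnit hg hM hy) (liftUnit hg hM hz) :=
  Units.ext (commute_liftAt hg hM hy hz)

lemma dil_liftAt_dil (hg : Generic q t) (hM : IsInterpFamily q t M) (a z : ℂ) (f : Poly m) :
    dil z⁻¹ (liftAt hg hM a (dil z f)) = liftAt hg hM (a * z) f := by
  rw [liftAt_apply, liftAt_apply, dil_dil, dil_dil, mul_inv, mul_comm a⁻¹]

lemma dil_liftUnit_inv_dil (hg : Generic q t) (hM : IsInterpFamily q t M) {a z : ℂ} (ha : a ≠ 0)
    (hz : z ≠ 0) (f : Poly m) :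
    dil z⁻¹ ((↑(liftUnit hg hM ha)⁻¹ : Module.End ℂ (Poly m)) (dil z f)) =
      (↑(liftUnit hg hM (mul_ne_zero ha hz))⁻¹ : Module.End ℂ (Poly m)) f := by
  rw [liftUnit_inv_apply, liftUnit_inv_apply, dil_dil, dil_dil, mul_inv, mul_comm a⁻¹]

/-- The operator whose matrix is given by the connection coefficients. -/
def connUnit (hg : Generic q t) (hM : IsInterpFamily q t M) {a b : ℂ} (ha : a ≠ 0) (hb : b ≠ 0) :
    (Module.End ℂ (Poly m))ˣ :=
  (liftUnit hg hM ha)⁻¹ * liftUnit hg hM hb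

lemma commute_connUnit (hg : Generic q t) (hM : IsInterpFamily q t M) {a b c d : ℂ} (ha : a ≠ 0)
    (hb : b ≠ 0) (hc : c ≠ 0) (hd : d ≠ 0) :
    Commute (connUnit hg hM ha hb) (connUnit hg hM hc hd) :=
  Commute.mul_left
    (Commute.inv_left (Commute.mul_right (Commute.inv_right (commute_liftUnit hg hM ha hc))
      (commute_liftUnit hg hM ha hd)))
    (Commute.mul_right (Commute.inv_right (commute_liftUnit hg hM hb hc))
      (commute_liftUnit hg hM hb hd))

lemma dil_connUnit_dil (hg : Generic q t) (hM : IsInterpFamily q t M) {a b z : ℂ} (ha : a ≠ 0)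
    (hb : b ≠ 0) (hz : z ≠ 0) (f : Poly m) :
    dil z⁻¹ ((connUnit hg hM ha hb : Module.End ℂ (Poly m)) (dil z f)) =
      (connUnit hg hM (mul_ne_zero ha hz) (mul_ne_zero hb hz) : Module.End ℂ (Poly m)) f := by
  rw [connUnit, Units.val_mul, Module.End.mul_apply, coe_liftUnit,
    ← dil_dil_inv hz (liftAt hg hM b (dil z f)), dil_liftUnit_inv_dil hg hM ha hz, dil_liftAt_dil]
  rfl

lemma connUnit_apply_eq (hg : Generic q t) (hM : IsInterpFamily q t M) {a b : ℂ} (ha : a ≠ 0)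
    (hb : b ≠ 0) {f g : Poly m} (h : liftAt hg hM b f = liftAt hg hM a g) :
    (connUnit hg hM ha hb : Module.End ℂ (Poly m)) f = g := by
  rw [connUnit, Units.val_mul, Module.End.mul_apply, coe_liftUnit, h, ← coe_liftUnit hg hM ha,
    ← Module.End.mul_apply, Units.inv_mul]
  rfl

lemma liftAt_topPart (hg : Generic q t) (hM : IsInterpFamily q t M) (z : ℂ)
    (u : Fin (m + 1) → ℕ) : liftAt hg hM z (topPart M u) = z ^ wt u • dil z⁻¹ (M u) := by
  rw [liftAt_apply, dil_of_isHomogeneous (isHomogeneous_topPart M u), map_smul, map_smul,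
    lift_topPart]

end Operators

section Connection

variable {m : ℕ} {q t : ℂ} {M : (Fin (m + 1) → ℕ) → Poly m}

lemma cp_ne_zero (hg : Generic q t) (u : Fin (m + 1) → ℕ) : cp q t u ≠ 0 := by
  refine Finset.prod_ne_zero_iff.2 fun i _ => Finset.prod_ne_zero_iff.2 fun j hj h => ?_
  have hj' := Finset.mem_range.1 hj
  have := (hg.pow_inj (c := 0) (d := 0) (by simpa using (sub_eq_zero.1 h).symm)).1
  omega

lemma topBasis_repr_lift_symm (hg : Generic q t) (hM : IsInterpFamily q t M) (f : Poly m) :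
    (topBasis hg hM).repr ((lift hg hM).symm f) = (interpBasis hg hM).repr f := by
  have : (lift hg hM).symm.trans (topBasis hg hM).repr = (interpBasis hg hM).repr := by
    refine (interpBasis hg hM).ext' fun u => ?_
    rw [LinearEquiv.trans_apply, Module.Basis.repr_self, interpBasis_apply,
      ← lift_topPart hg hM, LinearEquiv.symm_apply_apply, ← topBasis_apply hg hM,
      Module.Basis.repr_self]
  exact LinearEquiv.congr_fun this f

lemma entry_liftUnit_inv (hg : Generic q t) (hM : IsInterpFamily q t M) (u v : Fin (m + 1) → ℕ) :
    entry hg hM ↑(liftUnit hg hM one_ne_zero)⁻¹ u v =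
      (interpBasis hg hM).repr (topPart M u) v := by
  rw [entry, liftUnit_inv_apply, inv_one, dil_one, dil_one, topBasis_repr_lift_symm]

lemma qbin_eq (hg : Generic q t) (hM : IsInterpFamily q t M) (u v : Fin (m + 1) → ℕ) :
    qbin q t M u v = (prin q t M u)⁻¹ / (prin q t M v)⁻¹ *
      entry hg hM ↑(liftUnit hg hM one_ne_zero)⁻¹ u v := by
  have hu := prin_ne_zero hg hM u
  have hv := prin_ne_zero hg hM v
  have hN : q ^ nstat' v * t ^ nstat v / cp q t v ≠ 0 :=
    div_ne_zero (mul_ne_zero (pow_ne_zero _ hg.q_ne_zero) (pow_ne_zero _ hg.t_ne_zero))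
      (cp_ne_zero hg v)
  rw [entry_liftUnit_inv, repr_topPart, qbin, MM, map_mul, map_mul, eval_C, eval_C,
    mul_div_mul_left _ _ hN]
  field_simp

lemma finsum_qbin (hg : Generic q t) (hM : IsInterpFamily q t M) (u w : Fin (m + 1) → ℕ)
    (k : ℕ) :
    ∑ᶠ (v : Fin (m + 1) → ℕ) (_ : wt v = k), qbin q t M u v * qbin q t M v w =
      ∑ᶠ (v : Fin (m + 1) → ℕ) (_ : (wt v : ℤ) = (wt u : ℤ) + (wt w : ℤ) - (k : ℤ)),
        qbin q t M u v * qbin q t M v w := by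
  have h0 (u v : Fin (m + 1) → ℕ) (huv : wt u < wt v) :
      entry hg hM ↑(liftUnit hg hM one_ne_zero)⁻¹ u v = 0 := by
    rw [entry_liftUnit_inv]
    exact interpBasis_repr_eq_zero hg hM (topPart_mem_degLT M huv) le_rfl
  refine finsum_entry_mul_entry hg hM (fun u => inv_ne_zero (prin_ne_zero hg hM u))
    (qbin_eq hg hM) (qbin_eq hg hM) h0 h0 (fun z hz f => ?_) u w k
  rw [dil_liftUnit_inv_dil hg hM one_ne_zero hz, dil_liftUnit_inv_dil hg hM one_ne_zero hz,
    ← Module.End.mul_apply, ← Module.End.mul_apply, ← Units.val_mul, ← Units.val_mul,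
    ((commute_liftUnit hg hM (mul_ne_zero one_ne_zero hz) one_ne_zero).inv_inv).eq]

lemma eval_spec0div (a : ℂ) (f : Poly m) :
    eval (spec0div q t a) f = eval (spec q t 0) (dil a⁻¹ f) := by
  rw [dil, aeval_def, eval_eval₂]
  simp only [eval_mul, eval_C, eval_X]
  rw [eval, coe_eval₂Hom]
  congr 1
  · ext c
    simp
  · funext i
    exact div_eq_inv_mul _ _

lemma eval_EE (M : (Fin (m + 1) → ℕ) → Poly m) (a : ℂ) (u : Fin (m + 1) → ℕ) :
    eval (spec0div q t a) (EE q t M u) =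
      t ^ nstat u / cp q t u * (a⁻¹ ^ wt u * prin q t M u) := by
  rw [EE, map_mul, eval_C, eval_spec0div]
  change _ * eval _ (dil a⁻¹ (topPart M u)) = _
  rw [dil_of_isHomogeneous (isHomogeneous_topPart M u), smul_eval]
  rfl

lemma connUnit_topPart (hg : Generic q t) (hM : IsInterpFamily q t M) {a b : ℂ} (ha : a ≠ 0)
    (hb : b ≠ 0) {cc : (Fin (m + 1) → ℕ) → (Fin (m + 1) → ℕ) → ℂ}
    (h : IsConnection q t M a b cc) (u : Fin (m + 1) → ℕ) :
    (connUnit hg hM ha hb : Module.End ℂ (Poly m)) (topPart M u) =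
      ∑ v ∈ below u, (b ^ wt u * a⁻¹ ^ wt v * (q ^ nstat' v * t ^ nstat v / cp q t v) /
        (q ^ nstat' u * t ^ nstat u / cp q t u) * cc u v) • topPart M v := by
  have hN : q ^ nstat' u * t ^ nstat u / cp q t u ≠ 0 :=
    div_ne_zero (mul_ne_zero (pow_ne_zero _ hg.q_ne_zero) (pow_ne_zero _ hg.t_ne_zero))
      (cp_ne_zero hg u)
  have h1 : dil a (MM q t M u) = ∑ v ∈ below u, cc u v • dil b (MM q t M v) := by
    refine (h.2 u).trans (finsum_eq_sum_of_support_subset _ fun v hv => ?_)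
    by_contra hv'
    refine hv ?_
    change cc u v • _ = 0
    rw [h.1 u v (not_le.1 fun h => hv' (mem_below.2 h)), zero_smul]
  refine connUnit_apply_eq hg hM ha hb (smul_right_injective _ hN ?_)
  have h2 := congrArg (fun f => b ^ wt u • dil (a⁻¹ * b⁻¹) f) h1
  simp only [MM, map_sum, map_smul, dil_dil, ← smul_eq_C_mul] at h2
  rw [mul_right_comm, inv_mul_cancel₀ ha, one_mul] at h2
  simp only [map_sum, map_smul, liftAt_topPart]
  change _ • _ = _ • _
  rw [smul_comm, h2, Finset.smul_sum, Finset.smul_sum]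
  refine Finset.sum_congr rfl fun v _ => ?_
  rw [mul_assoc, inv_mul_cancel₀ hb, mul_one]
  simp only [smul_smul]
  congr 1
  have hq := hg.q_ne_zero
  have ht := hg.t_ne_zero
  have hcu := cp_ne_zero hg u
  rw [inv_pow]
  field_simp

lemma entry_connUnit (hg : Generic q t) (hM : IsInterpFamily q t M) {a b : ℂ} (ha : a ≠ 0)
    (hb : b ≠ 0) {cc : (Fin (m + 1) → ℕ) → (Fin (m + 1) → ℕ) → ℂ}
    (h : IsConnection q t M a b cc) (u v : Fin (m + 1) → ℕ) :
    entry hg hM (connUnit hg hM ha hb) u v =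
      b ^ wt u * a⁻¹ ^ wt v * (q ^ nstat' v * t ^ nstat v / cp q t v) /
        (q ^ nstat' u * t ^ nstat u / cp q t u) * cc u v := by
  rw [entry, connUnit_topPart hg hM ha hb h]
  simp only [← topBasis_apply hg hM, map_sum, map_smul, Module.Basis.repr_self,
    Finsupp.finsetSum_apply, Finsupp.smul_apply, Finsupp.single_apply, smul_eq_mul, mul_ite,
    mul_one, mul_zero, Finset.sum_ite_eq']
  split_ifs with hv
  · rfl
  · rw [h.1 u v (not_le.1 fun h => hv (mem_below.2 h)), mul_zero]

lemma skew_eq (hg : Generic q t) (hM : IsInterpFamily q t M) {a b : ℂ} (ha : a ≠ 0)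
    (hb : b ≠ 0) {cc : (Fin (m + 1) → ℕ) → (Fin (m + 1) → ℕ) → ℂ}
    (h : IsConnection q t M a b cc) (u v : Fin (m + 1) → ℕ) :
    skew q t M a b cc u v = q ^ nstat' u / prin q t M u / (q ^ nstat' v / prin q t M v) *
      entry hg hM (connUnit hg hM ha hb) u v := by
  have h1 := hg.q_ne_zero
  have h2 := hg.t_ne_zero
  have hu := prin_ne_zero hg hM u
  have hv := prin_ne_zero hg hM v
  have hcu := cp_ne_zero hg u
  have hcv := cp_ne_zero hg v
  rw [skew, eval_EE, eval_EE, entry_connUnit hg hM ha hb h]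
  simp only [inv_pow]
  field_simp

lemma finsum_skew (hg : Generic q t) (hM : IsInterpFamily q t M) {a b c d : ℂ} (ha : a ≠ 0)
    (hb : b ≠ 0) (hc : c ≠ 0) (hd : d ≠ 0) {cc cc' : (Fin (m + 1) → ℕ) → (Fin (m + 1) → ℕ) → ℂ}
    (h : IsConnection q t M a b cc) (h' : IsConnection q t M c d cc') (u w : Fin (m + 1) → ℕ)
    (k : ℕ) :
    ∑ᶠ (v : Fin (m + 1) → ℕ) (_ : wt v = k), skew q t M a b cc u v * skew q t M c d cc' v w =
      ∑ᶠ (v : Fin (m + 1) → ℕ) (_ : (wt v : ℤ) = (wt u : ℤ) + (wt w : ℤ) - (k : ℤ)),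
        skew q t M c d cc' u v * skew q t M a b cc v w := by
  refine finsum_entry_mul_entry hg hM
    (fun u => div_ne_zero (pow_ne_zero _ hg.q_ne_zero) (prin_ne_zero hg hM u))
    (skew_eq hg hM ha hb h) (skew_eq hg hM hc hd h')
    (fun u v huv => by rw [entry_connUnit hg hM ha hb h, h.1 u v huv, mul_zero])
    (fun u v huv => by rw [entry_connUnit hg hM hc hd h', h'.1 u v huv, mul_zero])
    (fun z hz f => ?_) u w k
  rw [dil_connUnit_dil hg hM ha hb hz, dil_connUnit_dil hg hM ha hb hz,
    ← Module.End.mul_apply, ← Module.End.mul_apply, ← Units.val_mul, ← Units.val_mul,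
    (commute_connUnit hg hM (mul_ne_zero ha hz) (mul_ne_zero hb hz) hc hd).eq]

end Connection

/-- **Duality, type I** (Proposition 6.9). -/
theorem duality_type_I
    (hn : 0 < n) (q t : ℂ) (hq0 : q ≠ 0) (ht : t ≠ 0)
    (hqt : ∀ i j : ℤ, ¬(i = 0 ∧ j = 0) → q ^ i * t ^ j ≠ 1)
    (M : (Fin n → ℕ) → MvPolynomial (Fin n) ℂ) (hM : IsInterpFamily q t M)
    (a b c d : ℂ) (ha : a ≠ 0) (hb : b ≠ 0) (hc : c ≠ 0) (hd : d ≠ 0)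
    (k : ℕ) (u w : Fin n → ℕ)
    (ccab cccd : (Fin n → ℕ) → (Fin n → ℕ) → ℂ)
    (h1 : IsConnection q t M a b ccab) (h2 : IsConnection q t M c d cccd) :
    ((∑ᶠ (v : Fin n → ℕ) (_ : wt v = k),
        skew q t M a b ccab u v * skew q t M c d cccd v w) =
      ∑ᶠ (v : Fin n → ℕ) (_ : (wt v : ℤ) = (wt u : ℤ) + (wt w : ℤ) - (k : ℤ)),
        skew q t M c d cccd u v * skew q t M a b ccab v w) ∧
    ((∑ᶠ (v : Fin n → ℕ) (_ : wt v = k), qbin q t M u v * qbin q t M v w) =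
      ∑ᶠ (v : Fin n → ℕ) (_ : (wt v : ℤ) = (wt u : ℤ) + (wt w : ℤ) - (k : ℤ)),
        qbin q t M u v * qbin q t M v w) := by
  obtain ⟨m, rfl⟩ : ∃ m, n = m + 1 := ⟨n - 1, by omega⟩
  have hg : Generic q t := ⟨hq0, ht, hqt⟩
  exact ⟨finsum_skew hg hM ha hb hc hd h1 h2 u w k, finsum_qbin hg hM u w k⟩

end LRW
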